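/- Let 1 < 𝔭 < ∞ and let w ∈ A_𝔭 (Muckenhoupt class) on ℝⁿ, so that the Hardy–Littlewood maximal operator is bounded on L^𝔭(w). Under the hypotheses of the pointwise inequality (Ω ∈ L^ρ(𝕊^{n-1}) mean zero, 1 < ρ < n, α ≥ ρn/(ρn+ρ−n), 1 < α < β < n), fix α < p < ∞ and w ∈ A_{p/α}. If ∇f ∈ Ṁ^{α, αn/β}(ℝⁿ) and ∇f ∈ L^p(w), then with q = p/(1−α/β): ‖T_Ω f‖_{L^q(w)} ≤ C ‖Ω‖_{L^ρ(𝕊^{n-1})} ‖∇f‖_{Ṁ^{α, αn/β}}^{α/β} ‖∇f‖_{L^p(w)}^{1−α/β}. -/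

import Mathlib

open MeasureTheory Metric Set ENNReal Filter

noncomputable def morreyNorm (n : ℕ) (p q : ℝ) (f : EuclideanSpace ℝ (Fin n) → ℝ) : ℝ≥0∞ :=
  ⨆ (x : EuclideanSpace ℝ (Fin n)) (r : ℝ) (_ : 0 < r),
    (ENNReal.ofReal (r ^ (-((n : ℝ) * (1 - p / q)))) *
      ∫⁻ y in ball x r, ENNReal.ofReal (|f y| ^ p)) ^ (1 / p)

/-- The Muckenhoupt `A_𝔭` condition for a weight `w` on `ℝⁿ` (`1 < 𝔭 < ∞`). -/
def IsMuckenhoupt (n : ℕ) (𝔭 : ℝ) (w : EuclideanSpace ℝ (Fin n) → ℝ) : Prop :=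
  ∃ A : ℝ, ∀ (z : EuclideanSpace ℝ (Fin n)) (r : ℝ), 0 < r →
    ((volume (ball z r))⁻¹ * ∫⁻ y in ball z r, ENNReal.ofReal (w y)) *
      ((volume (ball z r))⁻¹ *
        ∫⁻ y in ball z r, ENNReal.ofReal (w y ^ (-(1 / (𝔭 - 1))))) ^ (𝔭 - 1) ≤
      ENNReal.ofReal A

/-- The centred maximal function over balls whose radii are integer powers of two. -/
noncomputable def dyadicMaximal {X : Type*} [PseudoMetricSpace X] [MeasurableSpace X]
    (μ : Measure X) (H : X → ℝ≥0∞) (x : X) : ℝ≥0∞ :=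
  ⨆ k : ℤ, (μ (ball x (2 ^ k)))⁻¹ * ∫⁻ y in ball x (2 ^ k), H y ∂μ

theorem ENNReal.rpow_sub_one_mul_self (x : ℝ≥0∞) {s : ℝ} (hs : 1 ≤ s) : x ^ (s - 1) * x = x ^ s := by
  conv_lhs => rw [← ENNReal.rpow_one x, ← ENNReal.rpow_mul, one_mul]
  rw [← ENNReal.rpow_add_of_nonneg _ _ (by linarith) zero_le_one, sub_add_cancel]

theorem measurable_setLIntegral_ball {X : Type*} [PseudoMetricSpace X]
    [SecondCountableTopology X] [MeasurableSpace X] [BorelSpace X] (μ : Measure X) [SFinite μ]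
    {H : X → ℝ≥0∞} (hH : Measurable H) (r : ℝ) :
    Measurable fun x => ∫⁻ y in ball x r, H y ∂μ := by
  have hs : MeasurableSet {z : X × X | dist z.2 z.1 < r} :=
    measurableSet_lt (measurable_snd.dist measurable_fst) measurable_const
  convert! ((hH.comp measurable_snd).indicator hs).lintegral_prod_right' (ν := μ) using 2 with x
  rw [← lintegral_indicator measurableSet_ball]
  rfl

theorem measurable_dyadicMaximal {X : Type*} [PseudoMetricSpace X]
    [SecondCountableTopology X] [MeasurableSpace X] [BorelSpace X] (μ : Measure X) [SFinite μ]
    {H : X → ℝ≥0∞} (hH : Measurable H) : Measurable (dyadicMaximal μ H) := by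
  refine Measurable.iSup fun k => ?_
  have h1 := measurable_setLIntegral_ball μ (H := fun _ => 1) measurable_const (2 ^ k)
  simp only [setLIntegral_one] at h1
  exact h1.inv.mul (measurable_setLIntegral_ball μ hH _)

theorem exists_dyadicMaximal_weak_type (X : Type*) [MetricSpace X] [SecondCountableTopology X]
    [HasBesicovitchCovering X] [MeasurableSpace X] [BorelSpace X] :
    ∃ N : ℕ, ∀ (μ : Measure X) (H : X → ℝ≥0∞) (l : ℝ≥0∞),
      l * μ {x | l < dyadicMaximal μ H x} ≤ N * ∫⁻ x, H x ∂μ := by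
  obtain ⟨N, τ, hτ, hN⟩ := HasBesicovitchCovering.no_satelliteConfig (α := X)
  refine ⟨N, fun μ H l => ?_⟩
  let S : ℕ → Set X := fun m =>
    {x | ∃ k : ℤ, k ≤ m ∧ l < (μ (ball x (2 ^ k)))⁻¹ * ∫⁻ y in ball x (2 ^ k), H y ∂μ}
  have hS : Monotone S := fun a b hab x ⟨k, hk, h⟩ => ⟨k, hk.trans (by exact_mod_cast hab), h⟩
  have hU : {x | l < dyadicMaximal μ H x} = ⋃ m, S m := by
    ext x
    simp only [dyadicMaximal, mem_ofPred_eq, lt_iSup_iff, mem_iUnion, S]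
    constructor
    · rintro ⟨k, hk⟩
      exact ⟨k.toNat, k, Int.self_le_toNat k, hk⟩
    · rintro ⟨m, k, -, hk⟩
      exact ⟨k, hk⟩
  rw [hU, hS.measure_iUnion, ENNReal.mul_iSup]
  refine iSup_le fun m => ?_
  choose! k hkm hk using fun (x : X) (hx : x ∈ S m) => hx
  let q : Besicovitch.BallPackage (S m) X :=
    { c := fun x => x
      r := fun x => 2 ^ k x
      rpos := fun x => by positivity
      r_bound := 2 ^ (m : ℤ)
      r_le := fun x => zpow_le_zpow_right₀ one_le_two (hkm x x.2) }
  obtain ⟨s, hs, hcov⟩ := Besicovitch.exist_disjoint_covering_families hτ hN q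
  have hcov' : S m ⊆ ⋃ i, ⋃ j ∈ s i, ball (q.c j) (q.r j) := by
    simpa [q] using hcov
  have hdis : ∀ i, (s i).PairwiseDisjoint fun j => ball (q.c j) (q.r j) := fun i =>
    (hs i).mono_on fun _ _ => ball_subset_closedBall
  have hcount : ∀ i, (s i).Countable := fun i =>
    (hdis i).countable_of_isOpen (fun _ _ => isOpen_ball) fun j _ => nonempty_ball.2 (q.rpos j)
  have hball : ∀ j, l * μ (ball (q.c j) (q.r j)) ≤ ∫⁻ y in ball (q.c j) (q.r j), H y ∂μ := by
    intro j
    refine ENNReal.mul_le_of_le_div ?_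
    rw [div_eq_mul_inv, mul_comm]
    exact (hk j j.2).le
  calc l * μ (S m) ≤ l * ∑ i, ∑' j : s i, μ (ball (q.c j) (q.r j)) := by
        gcongr
        refine (measure_mono hcov').trans ((measure_iUnion_fintype_le _ _).trans ?_)
        exact Finset.sum_le_sum fun i _ => measure_biUnion_le μ (hcount i) _
    _ = ∑ i, ∑' j : s i, l * μ (ball (q.c j) (q.r j)) := by
        simp_rw [Finset.mul_sum, ENNReal.tsum_mul_left]
    _ ≤ ∑ i, ∑' j : s i, ∫⁻ y in ball (q.c j) (q.r j), H y ∂μ := by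
        gcongr with i _ j
        exact hball _
    _ = ∑ i, ∫⁻ y in ⋃ j ∈ s i, ball (q.c j) (q.r j), H y ∂μ := by
        refine Finset.sum_congr rfl fun i _ => ?_
        rw [lintegral_biUnion (hcount i) (fun _ _ => measurableSet_ball) (hdis i)]
    _ ≤ ∑ i : Fin N, ∫⁻ y, H y ∂μ := by
        gcongr
        exact Measure.restrict_le_self
    _ = N * ∫⁻ x, H x ∂μ := by simp

theorem tsum_two_zpow_rpow_le {δ : ℝ} (hδ : 0 < δ) : ∃ C : ℝ≥0∞, C ≠ ∞ ∧ C ≠ 0 ∧ ∀ k₀ : ℤ,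
    ∑' k : ℤ, (if k ≤ k₀ then ((2 : ℝ≥0∞) ^ k) ^ δ else 0) ≤ C * ((2 : ℝ≥0∞) ^ k₀) ^ δ := by
  have hlt : ((2 : ℝ≥0∞) ^ (-δ)) < 1 := ENNReal.rpow_lt_one_of_one_lt_of_neg (by norm_num) (by linarith)
  refine ⟨∑' i : ℕ, ((2 : ℝ≥0∞) ^ (-δ)) ^ i, ?_, ?_, fun k₀ => ?_⟩
  · rw [ENNReal.tsum_geometric]
    exact ENNReal.inv_ne_top.2 (tsub_pos_of_lt hlt).ne'
  · rw [ENNReal.tsum_geometric]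
    exact ENNReal.inv_ne_zero.2 (by simp)
  have hinj : Function.Injective fun i : ℕ => k₀ - (i : ℤ) := fun a b h => by
    simpa using h
  rw [← hinj.tsum_eq, ← ENNReal.tsum_mul_right]
  · refine ENNReal.tsum_le_tsum fun i => ?_
    rw [if_pos (by omega), ← ENNReal.rpow_intCast, ← ENNReal.rpow_intCast, ← ENNReal.rpow_natCast,
      ← ENNReal.rpow_mul, ← ENNReal.rpow_mul, ← ENNReal.rpow_mul,
      ← ENNReal.rpow_add _ _ (by norm_num) (by norm_num)]
    apply le_of_eq
    congr 1
    push_cast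
    ring
  · intro k hk
    have : k ≤ k₀ := by
      by_contra h
      simp [h] at hk
    exact ⟨(k₀ - k).toNat, by simp only; omega⟩

theorem rpow_le_tsum_two_zpow {s : ℝ} (hs : 0 < s) (a : ℝ≥0∞) :
    a ^ s ≤ ∑' k : ℤ, (if (2 : ℝ≥0∞) ^ k < a then ((2 : ℝ≥0∞) ^ (k + 1)) ^ s else 0) := by
  rw [← ENNReal.le_rpow_inv_iff hs]
  refine le_of_forall_lt_imp_le_of_dense fun b hb => ?_
  rcases eq_or_ne b 0 with rfl | hb0
  · exact zero_le
  obtain ⟨k, hk, hk'⟩ := ENNReal.exists_mem_Ioc_zpow hb0 hb.ne_top (y := 2) (by norm_num)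
    (by norm_num)
  rw [ENNReal.le_rpow_inv_iff hs]
  refine le_trans ?_ (ENNReal.le_tsum k)
  rw [if_pos (hk.trans hb)]
  gcongr

theorem tsum_two_zpow_lt_le {δ : ℝ} (hδ : 0 < δ) : ∃ C : ℝ≥0∞, C ≠ ∞ ∧ ∀ a : ℝ≥0∞,
    ∑' k : ℤ, (if (2 : ℝ≥0∞) ^ k < a then ((2 : ℝ≥0∞) ^ k) ^ δ else 0) ≤ C * a ^ δ := by
  obtain ⟨C, hC, hC0, h⟩ := tsum_two_zpow_rpow_le hδ
  refine ⟨C, hC, fun a => ?_⟩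
  rcases eq_or_ne a 0 with rfl | ha0
  · simp
  rcases eq_or_ne a ∞ with rfl | ha
  · simp [ENNReal.top_rpow_of_pos hδ, ENNReal.mul_top hC0]
  obtain ⟨k₀, hk₀, hk₁⟩ := ENNReal.exists_mem_Ioc_zpow ha0 ha (y := 2) (by norm_num) (by norm_num)
  refine (ENNReal.tsum_le_tsum fun k => ?_).trans ((h k₀).trans (by gcongr))
  split_ifs with h1 h2
  · rfl
  · exact absurd (h1.trans_le hk₁) (not_lt.2 (ENNReal.zpow_le_of_le (by norm_num) (by omega)))
  · exact zero_le
  · rfl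

theorem exists_dyadicMaximal_strong_type (X : Type*) [MetricSpace X] [SecondCountableTopology X]
    [HasBesicovitchCovering X] [MeasurableSpace X] [BorelSpace X] {s : ℝ} (hs : 1 < s) :
    ∃ C : ℝ≥0∞, C ≠ ∞ ∧ ∀ (μ : Measure X) [SFinite μ] (H : X → ℝ≥0∞), Measurable H →
      ∫⁻ x, dyadicMaximal μ H x ^ s ∂μ ≤ C * ∫⁻ x, H x ^ s ∂μ := by
  obtain ⟨N, hN⟩ := exists_dyadicMaximal_weak_type X
  obtain ⟨C, hC, hCs⟩ := tsum_two_zpow_lt_le (sub_pos.2 hs)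
  refine ⟨4 ^ s * N * C, by finiteness, fun μ _ H hH => ?_⟩
  have hM := measurable_dyadicMaximal μ hH
  have hs0 : 0 < s := by linarith
  have htail : ∀ l : ℝ≥0∞, l ≠ ∞ →
      l * μ {x | l + l < dyadicMaximal μ H x} ≤ N * ∫⁻ x, {y | l < H y}.indicator H x ∂μ := by
    intro l hl
    refine le_trans (mul_le_mul' le_rfl (measure_mono fun x hx => ?_))
      (hN μ ({y | l < H y}.indicator H) l)
    rw [mem_ofPred_eq, dyadicMaximal, lt_iSup_iff] at hx
    obtain ⟨k, hk⟩ := hx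
    rw [mem_ofPred_eq, dyadicMaximal]
    refine lt_of_lt_of_le ?_ (le_iSup _ k)
    refine lt_of_add_lt_add_right (hk.trans_le ?_)
    calc (μ (ball x (2 ^ k)))⁻¹ * ∫⁻ y in ball x (2 ^ k), H y ∂μ
        ≤ (μ (ball x (2 ^ k)))⁻¹ * ∫⁻ y in ball x (2 ^ k), ({y | l < H y}.indicator H y + l) ∂μ := by
          gcongr with y
          by_cases h : l < H y
          · simp [h]
          · simp [h, not_lt.1 h]
      _ = (μ (ball x (2 ^ k)))⁻¹ * ∫⁻ y in ball x (2 ^ k), {y | l < H y}.indicator H y ∂μ +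
          l * ((μ (ball x (2 ^ k)))⁻¹ * μ (ball x (2 ^ k))) := by
          rw [lintegral_add_right _ measurable_const, setLIntegral_const]
          ring
      _ ≤ _ := by
          gcongr
          exact mul_le_of_le_one_right' (ENNReal.inv_mul_le_one _)
  have hterm : ∀ k : ℤ, ((2 : ℝ≥0∞) ^ (k + 1)) ^ s * μ {x | 2 ^ k < dyadicMaximal μ H x} ≤
      4 ^ s * N * ∫⁻ x, H x * (if (2 : ℝ≥0∞) ^ (k - 1) < H x then
        ((2 : ℝ≥0∞) ^ (k - 1)) ^ (s - 1) else 0) ∂μ := by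
    intro k
    set l : ℝ≥0∞ := 2 ^ (k - 1) with hl
    have hl0 : l ≠ 0 := (ENNReal.zpow_pos (by norm_num) (by norm_num) _).ne'
    have hlt : l ≠ ∞ := (ENNReal.zpow_lt_top (by norm_num) (by norm_num) _).ne
    have h21 : ∀ m : ℤ, (2 : ℝ≥0∞) ^ (m + 1) = 2 ^ m * 2 := fun m => by
      rw [ENNReal.zpow_add (by norm_num) (by norm_num), zpow_one]
    have h2 : (2 : ℝ≥0∞) ^ k = l + l := by
      rw [← two_mul, mul_comm, hl, ← h21, sub_add_cancel]
    have h4 : (2 : ℝ≥0∞) ^ (k + 1) = 4 * l := by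
      rw [h21, h2, ← two_mul, mul_comm, ← mul_assoc]
      norm_num
    have hls : l ^ s = l ^ (s - 1) * l := (ENNReal.rpow_sub_one_mul_self l hs.le).symm
    rw [h2, h4, ENNReal.mul_rpow_of_nonneg _ _ hs0.le, hls]
    calc 4 ^ s * (l ^ (s - 1) * l) * μ {x | l + l < dyadicMaximal μ H x}
        = 4 ^ s * l ^ (s - 1) * (l * μ {x | l + l < dyadicMaximal μ H x}) := by ring
      _ ≤ 4 ^ s * l ^ (s - 1) * (N * ∫⁻ x, {y | l < H y}.indicator H x ∂μ) := by
          exact mul_le_mul' le_rfl (htail l hlt)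
      _ = 4 ^ s * N * (l ^ (s - 1) * ∫⁻ x, {y | l < H y}.indicator H x ∂μ) := by ring
      _ = _ := by
          rw [← lintegral_const_mul _ (hH.indicator (measurableSet_lt measurable_const hH))]
          congr 2 with x
          by_cases h : l < H x <;> simp [h, mul_comm]
  calc ∫⁻ x, dyadicMaximal μ H x ^ s ∂μ
      ≤ ∫⁻ x, ∑' k : ℤ, (if (2 : ℝ≥0∞) ^ k < dyadicMaximal μ H x then
          ((2 : ℝ≥0∞) ^ (k + 1)) ^ s else 0) ∂μ := by
        gcongr with x
        exact rpow_le_tsum_two_zpow hs0 _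
    _ = ∑' k : ℤ, ((2 : ℝ≥0∞) ^ (k + 1)) ^ s * μ {x | 2 ^ k < dyadicMaximal μ H x} := by
        have hm : ∀ k : ℤ, MeasurableSet {x | 2 ^ k < dyadicMaximal μ H x} := fun k =>
          measurableSet_lt measurable_const hM
        rw [lintegral_tsum fun k =>
          (Measurable.ite (hm k) measurable_const measurable_const).aemeasurable]
        congr 1 with k
        rw [← lintegral_indicator_const (hm k)]
        simp only [indicator_apply, mem_ofPred_eq]
    _ ≤ ∑' k : ℤ, 4 ^ s * N * ∫⁻ x, H x * (if (2 : ℝ≥0∞) ^ (k - 1) < H x then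
          ((2 : ℝ≥0∞) ^ (k - 1)) ^ (s - 1) else 0) ∂μ := ENNReal.tsum_le_tsum hterm
    _ = ∑' k : ℤ, 4 ^ s * N * ∫⁻ x, H x * (if (2 : ℝ≥0∞) ^ k < H x then
          ((2 : ℝ≥0∞) ^ k) ^ (s - 1) else 0) ∂μ :=
        (Equiv.subRight (1 : ℤ)).tsum_eq fun k : ℤ => 4 ^ s * N * ∫⁻ x, H x *
          (if (2 : ℝ≥0∞) ^ k < H x then ((2 : ℝ≥0∞) ^ k) ^ (s - 1) else 0) ∂μ
    _ = 4 ^ s * N * ∫⁻ x, H x * ∑' k : ℤ, (if (2 : ℝ≥0∞) ^ k < H x then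
          ((2 : ℝ≥0∞) ^ k) ^ (s - 1) else 0) ∂μ := by
        simp_rw [ENNReal.tsum_mul_left, ← ENNReal.tsum_mul_left (a := H _)]
        rw [lintegral_tsum]
        exact fun k => (hH.mul (Measurable.ite (measurableSet_lt measurable_const hH)
          measurable_const measurable_const)).aemeasurable
    _ ≤ 4 ^ s * N * ∫⁻ x, C * H x ^ s ∂μ := by
        refine mul_le_mul' le_rfl (lintegral_mono fun x => ?_)
        calc _ ≤ H x * (C * H x ^ (s - 1)) := mul_le_mul' le_rfl (hCs _)
          _ = C * (H x ^ (s - 1) * H x) := by ring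
          _ = C * H x ^ s := by rw [ENNReal.rpow_sub_one_mul_self _ hs.le]
    _ = _ := by
        rw [lintegral_const_mul _ (hH.pow_const s)]
        ring

theorem addHaar_ball_two_zpow_add_two {E : Type*} [NormedAddCommGroup E] [NormedSpace ℝ E]
    [FiniteDimensional ℝ E] [MeasurableSpace E] [BorelSpace E] (μ : Measure E)
    [μ.IsAddHaarMeasure] (x y : E) (k : ℤ) :
    μ (ball x (2 ^ (k + 2))) = 4 ^ Module.finrank ℝ E * μ (ball y (2 ^ k)) := by
  rw [Measure.addHaar_ball_of_pos _ _ (by positivity),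
    Measure.addHaar_ball_of_pos _ y (by positivity),
    ← mul_assoc]
  congr 1
  rw [zpow_add₀ two_ne_zero, mul_pow, mul_comm, ENNReal.ofReal_mul (by positivity)]
  congr 1
  rw [ENNReal.ofReal_pow (by positivity)]
  norm_num

theorem setLIntegral_ball_pos {E : Type*} [NormedAddCommGroup E] [MeasurableSpace E] [BorelSpace E]
    (μ : Measure E) [μ.IsOpenPosMeasure] {W : E → ℝ≥0∞} (hW : Measurable W) (hW0 : ∀ x, W x ≠ 0)
    (x : E) {r : ℝ} (hr : 0 < r) : ∫⁻ y in ball x r, W y ∂μ ≠ 0 := by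
  rw [← pos_iff_ne_zero, lintegral_pos_iff_support hW, (by ext; simp [hW0] : Function.support W = univ)]
  simpa using measure_ball_pos μ x hr

/-- The Muckenhoupt theorem for the dyadic-radius centred maximal operator. -/
theorem lintegral_dyadicMaximal_rpow_mul_le {E : Type*} [NormedAddCommGroup E] [NormedSpace ℝ E]
    [FiniteDimensional ℝ E] [MeasurableSpace E] [BorelSpace E] (μ : Measure E)
    [μ.IsAddHaarMeasure] {s : ℝ} (hs : 1 < s) {W : E → ℝ≥0∞} (hW : Measurable W)
    (hW0 : ∀ x, W x ≠ 0) (hWt : ∀ x, W x ≠ ∞) {A : ℝ≥0∞} (hA : A ≠ ∞)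
    (hWA : ∀ (z : E) (r : ℝ), 0 < r →
      ((μ (ball z r))⁻¹ * ∫⁻ y in ball z r, W y ∂μ) *
        ((μ (ball z r))⁻¹ * ∫⁻ y in ball z r, W y ^ (-(1 / (s - 1))) ∂μ) ^ (s - 1) ≤ A) :
    ∃ C : ℝ≥0∞, C ≠ ∞ ∧ ∀ H : E → ℝ≥0∞, Measurable H →
      ∫⁻ x, dyadicMaximal μ H x ^ s * W x ∂μ ≤ C * ∫⁻ x, H x ^ s * W x ∂μ := by
  have hs1 : 0 < s - 1 := sub_pos.2 hs
  have hs0 : 0 < s := by linarith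
  set V : E → ℝ≥0∞ := fun y => W y ^ (-(1 / (s - 1))) with hVdef
  have hV : Measurable V := hW.pow_const _
  have hV0 : ∀ x, V x ≠ 0 := fun x => by simp [hVdef, ENNReal.rpow_eq_zero_iff, hW0, hWt]
  have hVt : ∀ x, V x ≠ ∞ := fun x => by simp [hVdef, ENNReal.rpow_eq_top_iff, hW0, hWt]
  set w : Measure E := μ.withDensity W with hw
  set v : Measure E := μ.withDensity V with hv
  have hwB : ∀ z r, w (ball z r) = ∫⁻ y in ball z r, W y ∂μ := fun z r =>
    withDensity_apply _ measurableSet_ball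
  have hvB : ∀ z r, v (ball z r) = ∫⁻ y in ball z r, V y ∂μ := fun z r =>
    withDensity_apply _ measurableSet_ball
  have hμ0 : ∀ (z : E) {r : ℝ}, 0 < r → μ (ball z r) ≠ 0 := fun z r hr =>
    (measure_ball_pos μ z hr).ne'
  have hμt : ∀ (z : E) (r : ℝ), μ (ball z r) ≠ ∞ := fun z r => measure_ball_lt_top.ne
  have hw0 : ∀ z {r : ℝ}, 0 < r → w (ball z r) ≠ 0 := fun z r hr => by
    rw [hwB]; exact setLIntegral_ball_pos μ hW hW0 z hr
  have hv0 : ∀ z {r : ℝ}, 0 < r → v (ball z r) ≠ 0 := fun z r hr => by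
    rw [hvB]; exact setLIntegral_ball_pos μ hV hV0 z hr
  have hAp : ∀ z {r : ℝ}, 0 < r →
      w (ball z r) * v (ball z r) ^ (s - 1) ≤ A * μ (ball z r) ^ s := by
    intro z r hr
    have h := hWA z r hr
    rw [← hwB, ← hvB, ENNReal.mul_rpow_of_nonneg _ _ hs1.le] at h
    have hm : μ (ball z r) ^ s = μ (ball z r) * μ (ball z r) ^ (s - 1) := by
      rw [mul_comm, ENNReal.rpow_sub_one_mul_self _ hs.le]
    calc w (ball z r) * v (ball z r) ^ (s - 1)
        = (μ (ball z r))⁻¹ * μ (ball z r) * ((μ (ball z r))⁻¹ * μ (ball z r)) ^ (s - 1) *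
          (w (ball z r) * v (ball z r) ^ (s - 1)) := by
          rw [ENNReal.inv_mul_cancel (hμ0 z hr) (hμt z r)]
          simp
      _ = ((μ (ball z r))⁻¹ * w (ball z r) * ((μ (ball z r))⁻¹ ^ (s - 1) *
          v (ball z r) ^ (s - 1))) * μ (ball z r) ^ s := by
          rw [ENNReal.mul_rpow_of_nonneg _ _ hs1.le, hm]
          ring
      _ ≤ _ := by gcongr
  have hvt : ∀ z {r : ℝ}, 0 < r → v (ball z r) ≠ ∞ := by
    intro z r hr h
    have := hAp z hr
    rw [h, ENNReal.top_rpow_of_pos hs1, ENNReal.mul_top (hw0 z hr), top_le_iff] at this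
    exact ENNReal.mul_ne_top hA (ENNReal.rpow_ne_top_of_nonneg hs0.le (hμt z r)) this
  have hwt : ∀ z {r : ℝ}, 0 < r → w (ball z r) ≠ ∞ := by
    intro z r hr h
    have := hAp z hr
    rw [h, ENNReal.top_mul (by simp [ENNReal.rpow_eq_zero_iff, hv0 z hr, hvt z hr]),
      top_le_iff] at this
    exact ENNReal.mul_ne_top hA (ENNReal.rpow_ne_top_of_nonneg hs0.le (hμt z r)) this
  set D : ℝ≥0∞ := 4 ^ Module.finrank ℝ E with hD
  have hsc : s.HolderConjugate (s / (s - 1)) := Real.HolderConjugate.conjExponent hs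
  obtain ⟨C₁, hC₁, hM₁⟩ := exists_dyadicMaximal_strong_type E hs
  obtain ⟨C₂, hC₂, hM₂⟩ := exists_dyadicMaximal_strong_type E hsc.symm.lt
  refine ⟨(A * D ^ s) ^ (s / (s - 1)) * C₂ * C₁, ?_, fun H hH => ?_⟩
  · have : 0 ≤ s / (s - 1) := by positivity
    finiteness
  have hHV : Measurable fun y => H y * (V y)⁻¹ := hH.mul hV.inv
  set G : E → ℝ≥0∞ := dyadicMaximal v (fun y => H y * (V y)⁻¹) with hG
  have hGm : Measurable G := measurable_dyadicMaximal v hHV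
  have hvint : ∀ S : Set E, MeasurableSet S →
      ∫⁻ y in S, H y * (V y)⁻¹ ∂v = ∫⁻ y in S, H y ∂μ := by
    intro S hS
    rw [hv, setLIntegral_withDensity_eq_setLIntegral_mul _ hV hHV hS]
    refine lintegral_congr fun y => ?_
    rw [Pi.mul_apply, mul_left_comm, ENNReal.mul_inv_cancel (hV0 y) (hVt y), mul_one]
  set F : E → ℝ≥0∞ := fun y => G y ^ (s - 1) * (W y)⁻¹ with hF
  have hFm : Measurable F := (hGm.pow_const _).mul hW.inv
  have hwint : ∀ S : Set E, MeasurableSet S →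
      ∫⁻ y in S, F y ∂w = ∫⁻ y in S, G y ^ (s - 1) ∂μ := by
    intro S hS
    rw [hw, setLIntegral_withDensity_eq_setLIntegral_mul _ hW hFm hS]
    refine lintegral_congr fun y => ?_
    rw [Pi.mul_apply, mul_left_comm, ENNReal.mul_inv_cancel (hW0 y) (hWt y), mul_one]
  have hpt : ∀ x, dyadicMaximal μ H x ^ (s - 1) ≤ A * D ^ s * dyadicMaximal w F x := by
    intro x
    rw [← ENNReal.le_rpow_inv_iff hs1]
    refine iSup_le fun k => ?_
    rw [ENNReal.le_rpow_inv_iff hs1]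
    set Q := ball x ((2 : ℝ) ^ k) with hQ
    set Q' := ball x ((2 : ℝ) ^ (k + 2)) with hQ'
    have hk : (0 : ℝ) < 2 ^ k := by positivity
    have hk2 : (0 : ℝ) < 2 ^ (k + 2) := by positivity
    have e1 : (2 : ℝ) ^ (k + 1) = 2 * 2 ^ k := by rw [zpow_add₀ two_ne_zero]; ring
    have e2 : (2 : ℝ) ^ (k + 2) = 4 * 2 ^ k := by rw [zpow_add₀ two_ne_zero]; ring
    have hQQ : Q ⊆ Q' := ball_subset_ball (by linarith)
    have hI : ∀ y ∈ Q, (∫⁻ z in Q, H z ∂μ) ^ (s - 1) ≤ v Q' ^ (s - 1) * G y ^ (s - 1) := by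
      intro y hy
      rw [← ENNReal.mul_rpow_of_nonneg _ _ hs1.le]
      gcongr
      have hyx : dist y x < 2 ^ k := hy
      have hB1 : Q ⊆ ball y (2 ^ (k + 1)) := ball_subset (by rw [e1, dist_comm]; linarith)
      have hB2 : ball y (2 ^ (k + 1)) ⊆ Q' := ball_subset (by rw [e1, e2]; linarith)
      have hk1 : (0 : ℝ) < 2 ^ (k + 1) := by positivity
      calc ∫⁻ z in Q, H z ∂μ ≤ ∫⁻ z in ball y (2 ^ (k + 1)), H z ∂μ := lintegral_mono_set hB1
        _ = v (ball y (2 ^ (k + 1))) * ((v (ball y (2 ^ (k + 1))))⁻¹ *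
            ∫⁻ z in ball y (2 ^ (k + 1)), H z * (V z)⁻¹ ∂v) := by
            rw [ENNReal.mul_inv_cancel_left (hv0 y hk1) (hvt y hk1), hvint _ measurableSet_ball]
        _ ≤ v Q' * G y := by
            gcongr
            exact le_iSup (fun k : ℤ => (v (ball y (2 ^ k)))⁻¹ *
              ∫⁻ z in ball y (2 ^ k), H z * (V z)⁻¹ ∂v) (k + 1)
    have hInt : μ Q * (∫⁻ z in Q, H z ∂μ) ^ (s - 1) ≤
        w Q' * v Q' ^ (s - 1) * dyadicMaximal w F x := by
      calc μ Q * (∫⁻ z in Q, H z ∂μ) ^ (s - 1)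
          = ∫⁻ y in Q, (∫⁻ z in Q, H z ∂μ) ^ (s - 1) ∂μ := by rw [setLIntegral_const, mul_comm]
        _ ≤ ∫⁻ y in Q, v Q' ^ (s - 1) * G y ^ (s - 1) ∂μ :=
            setLIntegral_mono' measurableSet_ball hI
        _ = v Q' ^ (s - 1) * ∫⁻ y in Q, F y ∂w := by
            rw [lintegral_const_mul _ (hGm.pow_const _), hwint _ measurableSet_ball]
        _ = v Q' ^ (s - 1) * (w Q * ((w Q)⁻¹ * ∫⁻ y in Q, F y ∂w)) := by
            rw [ENNReal.mul_inv_cancel_left (hw0 x hk) (hwt x hk)]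
        _ ≤ v Q' ^ (s - 1) * (w Q' * dyadicMaximal w F x) := by
            gcongr
            exact le_iSup (fun k : ℤ => (w (ball x (2 ^ k)))⁻¹ * ∫⁻ z in ball x (2 ^ k), F z ∂w) k
        _ = _ := by ring
    have hμQ : μ Q' = D * μ Q := addHaar_ball_two_zpow_add_two μ x x k
    have hQ0 := hμ0 x hk
    have hQt := hμt x (2 ^ k)
    rw [ENNReal.mul_rpow_of_nonneg _ _ hs1.le]
    calc (μ Q)⁻¹ ^ (s - 1) * (∫⁻ z in Q, H z ∂μ) ^ (s - 1)
        = (μ Q)⁻¹ ^ (s - 1) * (μ Q)⁻¹ * (μ Q * (∫⁻ z in Q, H z ∂μ) ^ (s - 1)) := by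
          rw [mul_assoc, ENNReal.inv_mul_cancel_left hQ0 hQt]
      _ ≤ (μ Q)⁻¹ ^ (s - 1) * (μ Q)⁻¹ * (A * μ Q' ^ s * dyadicMaximal w F x) := by
          refine mul_le_mul' le_rfl (hInt.trans (mul_le_mul' (hAp x hk2) le_rfl))
      _ = A * D ^ s * dyadicMaximal w F x * ((μ Q)⁻¹ * μ Q) ^ s := by
          have hm : (μ Q)⁻¹ ^ s = (μ Q)⁻¹ ^ (s - 1) * (μ Q)⁻¹ :=
            (ENNReal.rpow_sub_one_mul_self _ hs.le).symm
          rw [hμQ, ENNReal.mul_rpow_of_nonneg _ _ hs0.le, ENNReal.mul_rpow_of_nonneg _ _ hs0.le, hm]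
          ring
      _ = _ := by rw [ENNReal.inv_mul_cancel hQ0 hQt]; simp
  have hwI : ∀ {K : E → ℝ≥0∞}, Measurable K → ∫⁻ x, K x ∂w = ∫⁻ x, W x * K x ∂μ := fun hK => by
    rw [hw, lintegral_withDensity_eq_lintegral_mul _ hW hK]; rfl
  have hvI : ∀ {K : E → ℝ≥0∞}, Measurable K → ∫⁻ x, K x ∂v = ∫⁻ x, V x * K x ∂μ := fun hK => by
    rw [hv, lintegral_withDensity_eq_lintegral_mul _ hV hK]; rfl
  have hσ0 : 0 < s / (s - 1) := by positivity
  calc ∫⁻ x, dyadicMaximal μ H x ^ s * W x ∂μ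
      ≤ ∫⁻ x, (A * D ^ s) ^ (s / (s - 1)) * (W x * dyadicMaximal w F x ^ (s / (s - 1))) ∂μ := by
        refine lintegral_mono fun x => ?_
        rw [mul_left_comm, ← ENNReal.mul_rpow_of_nonneg _ _ hσ0.le, mul_comm]
        gcongr
        calc dyadicMaximal μ H x ^ s = (dyadicMaximal μ H x ^ (s - 1)) ^ (s / (s - 1)) := by
              rw [← ENNReal.rpow_mul, mul_div_cancel₀ _ hs1.ne']
          _ ≤ _ := by gcongr; exact hpt x
    _ = (A * D ^ s) ^ (s / (s - 1)) * ∫⁻ x, dyadicMaximal w F x ^ (s / (s - 1)) ∂w := by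
        have hm : Measurable fun x => dyadicMaximal w F x ^ (s / (s - 1)) :=
          (measurable_dyadicMaximal w hFm).pow_const (s / (s - 1))
        have hWm : Measurable fun x => W x * dyadicMaximal w F x ^ (s / (s - 1)) := hW.mul hm
        rw [lintegral_const_mul _ hWm, hwI hm]
    _ ≤ (A * D ^ s) ^ (s / (s - 1)) * (C₂ * ∫⁻ x, F x ^ (s / (s - 1)) ∂w) := by
        gcongr; exact hM₂ w F hFm
    _ = (A * D ^ s) ^ (s / (s - 1)) * (C₂ * ∫⁻ x, G x ^ s ∂v) := by
        rw [hwI (hFm.pow_const _), hvI (hGm.pow_const _)]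
        congr 3 with x
        simp only [hF, hVdef]
        rw [ENNReal.mul_rpow_of_nonneg _ _ hσ0.le, ← ENNReal.rpow_mul, mul_div_cancel₀ _ hs1.ne',
          mul_left_comm, mul_comm (W x ^ _), ENNReal.inv_rpow, ← ENNReal.rpow_neg]
        congr 1
        conv_lhs => rw [← ENNReal.rpow_one (W x), ← ENNReal.rpow_mul, one_mul]
        rw [← ENNReal.rpow_add _ _ (hW0 x) (hWt x)]
        congr 1
        field_simp
        ring
    _ ≤ (A * D ^ s) ^ (s / (s - 1)) * (C₂ * (C₁ * ∫⁻ x, (H x * (V x)⁻¹) ^ s ∂v)) := by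
        gcongr; exact hM₁ v _ hHV
    _ = (A * D ^ s) ^ (s / (s - 1)) * C₂ * C₁ * ∫⁻ x, H x ^ s * W x ∂μ := by
        rw [hvI (hHV.pow_const _), mul_assoc, mul_assoc]
        congr 4 with x
        rw [ENNReal.mul_rpow_of_nonneg _ _ hs0.le, mul_left_comm, ENNReal.inv_rpow,
          ← ENNReal.rpow_neg]
        congr 1
        have hVV : V x * V x ^ (-s) = V x ^ (1 - s) := by
          rw [sub_eq_add_neg, ENNReal.rpow_add _ _ (hV0 x) (hVt x), ENNReal.rpow_one]
        rw [hVV]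
        simp only [hVdef]
        rw [← ENNReal.rpow_mul]
        have he : -(1 / (s - 1)) * (1 - s) = 1 := by field_simp; ring
        rw [he, ENNReal.rpow_one]

theorem enorm_sub_le_enorm_mul_lintegral_fderiv {E : Type*} [NormedAddCommGroup E] [NormedSpace ℝ E]
    [MeasurableSpace E] [BorelSpace E] {f : E → ℝ} (hf : Differentiable ℝ f) (y z : E) :
    ‖f z - f y‖ₑ ≤ ‖z - y‖ₑ * ∫⁻ t in Ioc (0 : ℝ) 1, ‖fderiv ℝ f (y + t • (z - y))‖ₑ := by
  rcases eq_or_ne z y with rfl | hzy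
  · simp
  have hzy' : ‖z - y‖ₑ ≠ 0 := by simpa [sub_eq_zero] using hzy
  by_cases htop : ∫⁻ t in Ioc (0 : ℝ) 1, ‖fderiv ℝ f (y + t • (z - y))‖ₑ = ∞
  · rw [htop, ENNReal.mul_top hzy']; exact le_top
  have hline : Continuous fun t : ℝ => y + t • (z - y) := by fun_prop
  have hm : Measurable fun t : ℝ => fderiv ℝ f (y + t • (z - y)) (z - y) :=
    (measurable_fderiv_apply_const ℝ f (z - y)).comp hline.measurable
  have hle : ∀ t : ℝ, ‖fderiv ℝ f (y + t • (z - y)) (z - y)‖ₑ ≤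
      ‖z - y‖ₑ * ‖fderiv ℝ f (y + t • (z - y))‖ₑ := fun t => by
    rw [mul_comm]; exact ContinuousLinearMap.le_opENorm _ _
  have hbound : ∫⁻ t in Ioc (0 : ℝ) 1, ‖fderiv ℝ f (y + t • (z - y)) (z - y)‖ₑ ≤
      ‖z - y‖ₑ * ∫⁻ t in Ioc (0 : ℝ) 1, ‖fderiv ℝ f (y + t • (z - y))‖ₑ := by
    rw [← lintegral_const_mul' _ _ enorm_ne_top]
    exact lintegral_mono hle
  have hInt : IntervalIntegrable (fun t : ℝ => fderiv ℝ f (y + t • (z - y)) (z - y)) volume 0 1 := by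
    rw [intervalIntegrable_iff_integrableOn_Ioc_of_le zero_le_one]
    exact ⟨hm.aestronglyMeasurable,
      hbound.trans_lt (ENNReal.mul_lt_top enorm_lt_top (lt_top_iff_ne_top.2 htop))⟩
  have hderiv : ∀ t ∈ uIcc (0 : ℝ) 1, HasDerivAt (fun t : ℝ => f (y + t • (z - y)))
      (fderiv ℝ f (y + t • (z - y)) (z - y)) t := fun t _ => by
    have h1 : HasDerivAt (fun t : ℝ => y + t • (z - y)) (z - y) t := by
      simpa using ((hasDerivAt_id t).smul_const (z - y)).const_add y
    exact (hf _).hasFDerivAt.comp_hasDerivAt t h1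
  have hFTC := intervalIntegral.integral_eq_sub_of_hasDerivAt hderiv hInt
  rw [intervalIntegral.integral_of_le zero_le_one] at hFTC
  simp only [one_smul, zero_smul, add_zero, add_sub_cancel] at hFTC
  rw [← hFTC]
  exact (enorm_integral_le_lintegral_enorm _).trans hbound

section
variable {E : Type*} [NormedAddCommGroup E] [NormedSpace ℝ E] [FiniteDimensional ℝ E]
  [MeasurableSpace E] [BorelSpace E] (μ : Measure E) [μ.IsAddHaarMeasure]

theorem lintegral_comp_add_smul_sub_le {H : E → ℝ≥0∞} (hH : Measurable H) (y : E) {t : ℝ}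
    (ht : 1 / 2 ≤ t) :
    ∫⁻ z, H (y + t • (z - y)) ∂μ ≤ 2 ^ Module.finrank ℝ E * ∫⁻ z, H z ∂μ := by
  have ht0 : t ≠ 0 := by linarith
  have hcont : Measurable fun z : E => t • z := measurable_const_smul t
  have e1 : ∫⁻ z, H (y + t • (z - y)) ∂μ = ∫⁻ z, H (y + t • z) ∂μ :=
    lintegral_sub_right_eq_self (μ := μ) (fun z => H (y + t • z)) y
  have hH' : Measurable fun z : E => H (y + z) := hH.comp (measurable_const_add y)
  have e2 : ∫⁻ z, H (y + t • z) ∂μ = ∫⁻ z, H (y + z) ∂(μ.map (t • ·)) :=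
    (lintegral_map hH' hcont).symm
  rw [e1, e2, Measure.map_addHaar_smul _ ht0, lintegral_smul_measure,
    lintegral_add_left_eq_self (μ := μ) H y, smul_eq_mul]
  gcongr
  rw [abs_of_nonneg (by positivity)]
  calc ENNReal.ofReal ((t ^ Module.finrank ℝ E)⁻¹) ≤ ENNReal.ofReal (2 ^ Module.finrank ℝ E) := by
        apply ENNReal.ofReal_le_ofReal
        rw [← inv_pow]
        gcongr
        rw [inv_le_comm₀ (by linarith) two_pos]
        simpa using ht
    _ = _ := by rw [ENNReal.ofReal_pow zero_le_two]; norm_num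

theorem setLIntegral_setLIntegral_comp_segment_le {H : E → ℝ≥0∞} (hH : Measurable H) (x : E) (r : ℝ)
    {t : ℝ} (ht0 : 0 ≤ t) (ht1 : t ≤ 1) :
    ∫⁻ y in ball x r, ∫⁻ z in ball x r, H (y + t • (z - y)) ∂μ ∂μ ≤
      2 ^ Module.finrank ℝ E * μ (ball x r) * ∫⁻ z in ball x r, H z ∂μ := by
  have key : ∀ s : ℝ, 1 / 2 ≤ s → s ≤ 1 →
      ∫⁻ y in ball x r, ∫⁻ z in ball x r, H (y + s • (z - y)) ∂μ ∂μ ≤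
      2 ^ Module.finrank ℝ E * μ (ball x r) * ∫⁻ z in ball x r, H z ∂μ := by
    intro s hs hs1
    calc ∫⁻ y in ball x r, ∫⁻ z in ball x r, H (y + s • (z - y)) ∂μ ∂μ
        ≤ ∫⁻ y in ball x r, 2 ^ Module.finrank ℝ E * ∫⁻ z in ball x r, H z ∂μ ∂μ := by
          refine setLIntegral_mono' measurableSet_ball fun y hy => ?_
          calc ∫⁻ z in ball x r, H (y + s • (z - y)) ∂μ
              ≤ ∫⁻ z in ball x r, (ball x r).indicator H (y + s • (z - y)) ∂μ := by
                refine setLIntegral_mono' measurableSet_ball fun z hz => ?_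
                rw [indicator_of_mem]
                exact (convex_ball x r).add_smul_sub_mem hy hz ⟨by linarith, hs1⟩
            _ ≤ ∫⁻ z, (ball x r).indicator H (y + s • (z - y)) ∂μ := setLIntegral_le_lintegral _ _
            _ ≤ _ := by
                refine (lintegral_comp_add_smul_sub_le μ (hH.indicator measurableSet_ball) y hs).trans ?_
                rw [lintegral_indicator measurableSet_ball]
      _ = _ := by rw [setLIntegral_const]; ring
  rcases le_total (1 / 2) t with h | h
  · exact key t h ht1
  · have hm : Measurable fun p : E × E => H (p.1 + t • (p.2 - p.1)) := hH.comp (by fun_prop)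
    rw [lintegral_lintegral_swap hm.aemeasurable]
    refine le_trans (le_of_eq ?_) (key (1 - t) (by linarith) (by linarith))
    congr 1 with y
    congr 1 with z
    congr 1
    module

/-- An `L¹` Poincaré inequality on balls, in double-integral form. -/
theorem setLIntegral_setLIntegral_enorm_sub_le {f : E → ℝ} (hf : Differentiable ℝ f) (x : E) (r : ℝ) :
    ∫⁻ y in ball x r, ∫⁻ z in ball x r, ‖f z - f y‖ₑ ∂μ ∂μ ≤
      ENNReal.ofReal (2 * r) * (2 ^ Module.finrank ℝ E * μ (ball x r) *
        ∫⁻ z in ball x r, ‖fderiv ℝ f z‖ₑ ∂μ) := by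
  set H : E → ℝ≥0∞ := fun z => ‖fderiv ℝ f z‖ₑ with hHdef
  have hH : Measurable H := (measurable_fderiv ℝ f).enorm
  have hm3 : Measurable fun p : (E × E) × ℝ => H (p.1.1 + p.2 • (p.1.2 - p.1.1)) :=
    hH.comp (by fun_prop)
  have hm3' : Measurable fun p : (E × ℝ) × E => H (p.1.1 + p.1.2 • (p.2 - p.1.1)) :=
    hH.comp (by fun_prop)
  calc ∫⁻ y in ball x r, ∫⁻ z in ball x r, ‖f z - f y‖ₑ ∂μ ∂μ
      ≤ ∫⁻ y in ball x r, ∫⁻ z in ball x r, ENNReal.ofReal (2 * r) *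
          ∫⁻ t in Ioc (0 : ℝ) 1, H (y + t • (z - y)) ∂volume ∂μ ∂μ := by
        refine setLIntegral_mono' measurableSet_ball fun y hy => ?_
        refine setLIntegral_mono' measurableSet_ball fun z hz => ?_
        refine (enorm_sub_le_enorm_mul_lintegral_fderiv hf y z).trans ?_
        refine mul_le_mul' ?_ le_rfl
        rw [← ofReal_norm]
        apply ENNReal.ofReal_le_ofReal
        rw [← dist_eq_norm]
        have := dist_triangle_right z y x
        rw [mem_ball] at hy hz
        linarith
    _ = ENNReal.ofReal (2 * r) * ∫⁻ y in ball x r, ∫⁻ z in ball x r,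
          ∫⁻ t in Ioc (0 : ℝ) 1, H (y + t • (z - y)) ∂volume ∂μ ∂μ := by
        rw [← lintegral_const_mul' _ _ ofReal_ne_top]
        congr 1 with y
        rw [lintegral_const_mul' _ _ ofReal_ne_top]
    _ = ENNReal.ofReal (2 * r) * ∫⁻ y in ball x r, ∫⁻ t in Ioc (0 : ℝ) 1, ∫⁻ z in ball x r,
           H (y + t • (z - y)) ∂μ ∂volume ∂μ := by
        congr 1
        refine lintegral_congr fun y => ?_
        rw [lintegral_lintegral_swap]
        exact (hm3.comp (by fun_prop : Measurable fun p : E × ℝ => ((y, p.1), p.2))).aemeasurable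
    _ = ENNReal.ofReal (2 * r) * ∫⁻ t in Ioc (0 : ℝ) 1, ∫⁻ y in ball x r, ∫⁻ z in ball x r,
           H (y + t • (z - y)) ∂μ ∂μ := by
        rw [lintegral_lintegral_swap]
        exact hm3'.lintegral_prod_right'.aemeasurable
    _ ≤ ENNReal.ofReal (2 * r) * ∫⁻ t in Ioc (0 : ℝ) 1, 2 ^ Module.finrank ℝ E * μ (ball x r) *
        ∫⁻ z in ball x r, H z ∂μ := by
        refine mul_le_mul' le_rfl ?_
        exact setLIntegral_mono' measurableSet_Ioc fun t ht =>
          setLIntegral_setLIntegral_comp_segment_le μ hH x r ht.1.le ht.2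
    _ = _ := by simp

theorem enorm_setAverage_sub_le {f : E → ℝ} (hf : Continuous f) (x : E) {r : ℝ} (hr : 0 < r) (c : ℝ) :
    ‖(⨍ z in ball x r, f z ∂μ) - c‖ₑ ≤ (μ (ball x r))⁻¹ * ∫⁻ z in ball x r, ‖f z - c‖ₑ ∂μ := by
  have hμ0 : μ (ball x r) ≠ 0 := (measure_ball_pos μ x hr).ne'
  have hμt : μ (ball x r) ≠ ∞ := measure_ball_lt_top.ne
  have hInt : IntegrableOn f (ball x r) μ :=
    (hf.continuousOn.integrableOn_compact (isCompact_closedBall x r)).mono_set ball_subset_closedBall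
  have h1 : (⨍ z in ball x r, f z ∂μ) - c = ⨍ z in ball x r, (f z - c) ∂μ := by
    rw [setAverage_eq, setAverage_eq, integral_sub hInt (integrableOn_const hμt), setIntegral_const]
    have : μ.real (ball x r) ≠ 0 := by simp [Measure.real, ENNReal.toReal_eq_zero_iff, hμ0, hμt]
    simp only [smul_eq_mul]
    field_simp
  rw [h1, setAverage_eq, enorm_smul]
  refine mul_le_mul' (le_of_eq ?_) (enorm_integral_le_lintegral_enorm _)
  rw [enorm_inv, Measure.real, Real.enorm_of_nonneg ENNReal.toReal_nonneg, ENNReal.ofReal_toReal hμt]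
  simp [Measure.real, ENNReal.toReal_eq_zero_iff, hμ0, hμt]

/-- Comparison of averages on nested balls. -/
theorem enorm_setAverage_sub_setAverage_le {f : E → ℝ} (hf : Differentiable ℝ f) {x y : E} {r s : ℝ}
    (hs : 0 < s) (hr : 0 < r) (hsub : ball y s ⊆ ball x r) :
    ‖(⨍ z in ball y s, f z ∂μ) - ⨍ z in ball x r, f z ∂μ‖ₑ ≤
      ENNReal.ofReal (2 * r) * 2 ^ Module.finrank ℝ E *
        ((μ (ball y s))⁻¹ * ∫⁻ z in ball x r, ‖fderiv ℝ f z‖ₑ ∂μ) := by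
  have hμ0 : μ (ball x r) ≠ 0 := (measure_ball_pos μ x hr).ne'
  have hμt : μ (ball x r) ≠ ∞ := measure_ball_lt_top.ne
  calc _ ≤ (μ (ball y s))⁻¹ * ∫⁻ w in ball y s, ‖f w - ⨍ z in ball x r, f z ∂μ‖ₑ ∂μ :=
        enorm_setAverage_sub_le μ hf.continuous y hs _
    _ ≤ (μ (ball y s))⁻¹ * ∫⁻ w in ball x r, ‖f w - ⨍ z in ball x r, f z ∂μ‖ₑ ∂μ := by
        gcongr
    _ ≤ (μ (ball y s))⁻¹ * ∫⁻ w in ball x r, (μ (ball x r))⁻¹ *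
          ∫⁻ z in ball x r, ‖f z - f w‖ₑ ∂μ ∂μ := by
        gcongr with w
        rw [enorm_sub_rev]
        exact enorm_setAverage_sub_le μ hf.continuous x hr _
    _ ≤ (μ (ball y s))⁻¹ * ((μ (ball x r))⁻¹ * (ENNReal.ofReal (2 * r) *
          (2 ^ Module.finrank ℝ E * μ (ball x r) * ∫⁻ z in ball x r, ‖fderiv ℝ f z‖ₑ ∂μ))) := by
        rw [lintegral_const_mul' _ _ (ENNReal.inv_ne_top.2 hμ0)]
        gcongr
        exact setLIntegral_setLIntegral_enorm_sub_le μ hf x r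
    _ = ((μ (ball x r))⁻¹ * μ (ball x r)) * (ENNReal.ofReal (2 * r) * 2 ^ Module.finrank ℝ E *
        ((μ (ball y s))⁻¹ * ∫⁻ z in ball x r, ‖fderiv ℝ f z‖ₑ ∂μ)) := by ring
    _ = _ := by rw [ENNReal.inv_mul_cancel hμ0 hμt, one_mul]
end

theorem tsum_zpow_min_le {γ : ℝ} (hγ : 0 < γ) :
    ∃ C : ℝ≥0∞, C ≠ ∞ ∧ ∀ (a b : ℝ≥0∞) (u : ℤ → ℝ≥0∞), (∀ k, u k ≤ 2 ^ k * a) →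
      (∀ k, u k ≤ ((2 : ℝ≥0∞) ^ k) ^ (-γ) * b) →
      ∑' k, u k ≤ C * (a ^ (γ / (1 + γ)) * b ^ (1 / (1 + γ))) := by
  obtain ⟨C₁, hC₁, hC₁0, h₁⟩ := tsum_two_zpow_rpow_le one_pos
  obtain ⟨C₂, hC₂, hC₂0, h₂⟩ := tsum_two_zpow_rpow_le hγ
  have hγ1 : 0 < γ / (1 + γ) := by positivity
  have hγ2 : 0 < 1 / (1 + γ) := by positivity
  have h1γ : 1 + γ ≠ 0 := by positivity
  have hC0 : C₁ + C₂ ≠ 0 := by simp [hC₁0]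
  refine ⟨C₁ + C₂, by finiteness, fun a b u hua hub => ?_⟩
  rcases eq_or_ne a 0 with rfl | ha0
  · have : ∀ k, u k = 0 := fun k => by simpa using hua k
    simp [this]
  rcases eq_or_ne b 0 with rfl | hb0
  · have : ∀ k, u k = 0 := fun k => by simpa using hub k
    simp [this]
  rcases eq_or_ne a ∞ with rfl | hat
  · rw [ENNReal.top_rpow_of_pos hγ1, ENNReal.top_mul (by simp [ENNReal.rpow_eq_zero_iff, hb0]; intros; linarith), ENNReal.mul_top hC0]
    exact le_top
  rcases eq_or_ne b ∞ with rfl | hbt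
  · rw [ENNReal.top_rpow_of_pos hγ2, ENNReal.mul_top (by simp [ENNReal.rpow_eq_zero_iff, ha0, hat]), ENNReal.mul_top hC0]
    exact le_top
  set R : ℝ≥0∞ := (b / a) ^ (1 / (1 + γ)) with hR
  have hba0 : b / a ≠ 0 := by simp [hb0, hat]
  have hbat : b / a ≠ ∞ := ENNReal.div_ne_top hbt ha0
  have hR0 : R ≠ 0 := by simp [hR, ENNReal.rpow_eq_zero_iff, hba0, hbat]
  have hRt : R ≠ ∞ := ENNReal.rpow_ne_top_of_nonneg hγ2.le hbat
  obtain ⟨k₀, hk₀, hk₀'⟩ := ENNReal.exists_mem_Ico_zpow hR0 hRt (by norm_num : (1 : ℝ≥0∞) < 2) (by simp)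
  have hRa : R * a = a ^ (γ / (1 + γ)) * b ^ (1 / (1 + γ)) := by
    have : a = a ^ (1 / (1 + γ)) * a ^ (γ / (1 + γ)) := by
      rw [← ENNReal.rpow_add _ _ ha0 hat, ← add_div, div_self h1γ, ENNReal.rpow_one]
    rw [hR, ENNReal.div_rpow_of_nonneg _ _ hγ2.le]
    conv_lhs => rw [this]
    rw [← mul_assoc, mul_comm]
    congr 1
    rw [← this]
    refine ENNReal.div_mul_cancel ?_ ?_
    · simp [ENNReal.rpow_eq_zero_iff, ha0, hat]
    · exact ENNReal.rpow_ne_top_of_nonneg hγ2.le hat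
  have hRb : R ^ (-γ) * b = a ^ (γ / (1 + γ)) * b ^ (1 / (1 + γ)) := by
    have : R ^ (-γ) * b = R ^ (-γ) * (R ^ (1 + γ) * a) := by
      rw [hR, ← ENNReal.rpow_mul _ (1 / (1 + γ)) (1 + γ), one_div_mul_cancel h1γ, ENNReal.rpow_one,
        ENNReal.div_mul_cancel ha0 hat]
    rw [this, ← mul_assoc, ← ENNReal.rpow_add _ _ hR0 hRt]
    rw [show -γ + (1 + γ) = 1 by ring, ENNReal.rpow_one, hRa]
  have hsplit : ∀ k, u k ≤ (if k ≤ k₀ then ((2 : ℝ≥0∞) ^ k) ^ (1 : ℝ) else 0) * a +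
      (if -k ≤ -(k₀ + 1) then ((2 : ℝ≥0∞) ^ (-k)) ^ γ else 0) * b := by
    intro k
    by_cases hk : k ≤ k₀
    · simp only [hk, if_true, ENNReal.rpow_one]
      exact (hua k).trans le_self_add
    · have hk' : -k ≤ -(k₀ + 1) := by omega
      simp only [hk, hk', if_true, if_false, zero_mul, zero_add]
      refine (hub k).trans (le_of_eq ?_)
      rw [ENNReal.zpow_neg, ENNReal.inv_rpow, ENNReal.rpow_neg]
  calc ∑' k, u k ≤ (∑' k : ℤ, if k ≤ k₀ then ((2 : ℝ≥0∞) ^ k) ^ (1 : ℝ) else 0) * a +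
      (∑' k : ℤ, if -k ≤ -(k₀ + 1) then ((2 : ℝ≥0∞) ^ (-k)) ^ γ else 0) * b := by
        rw [← ENNReal.tsum_mul_right, ← ENNReal.tsum_mul_right, ← ENNReal.tsum_add]
        exact ENNReal.tsum_le_tsum hsplit
    _ ≤ C₁ * (R * a) + C₂ * (R ^ (-γ) * b) := by
        rw [← mul_assoc, ← mul_assoc]
        refine add_le_add (mul_le_mul' ?_ le_rfl) (mul_le_mul' ?_ le_rfl)
        · refine (h₁ k₀).trans (mul_le_mul' le_rfl ?_)
          rwa [ENNReal.rpow_one]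
        · have := (Equiv.neg ℤ).tsum_eq fun k : ℤ =>
            if k ≤ -(k₀ + 1) then ((2 : ℝ≥0∞) ^ k) ^ γ else 0
          simp only [Equiv.neg_apply] at this
          rw [this]
          refine (h₂ _).trans (mul_le_mul' le_rfl ?_)
          rw [ENNReal.zpow_neg, ENNReal.inv_rpow, ← ENNReal.rpow_neg]
          rw [ENNReal.rpow_neg, ENNReal.rpow_neg, ENNReal.inv_le_inv]
          exact ENNReal.rpow_le_rpow hk₀'.le hγ.le
    _ = _ := by rw [hRa, hRb, add_mul]

theorem ofReal_two_zpow (i : ℤ) : ENNReal.ofReal ((2 : ℝ) ^ i) = 2 ^ i := by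
  rw [← ENNReal.rpow_intCast, ← Real.rpow_intCast, ← ENNReal.ofReal_rpow_of_pos two_pos]
  norm_num

section
variable {E : Type*} [NormedAddCommGroup E] [NormedSpace ℝ E] [FiniteDimensional ℝ E]
  [MeasurableSpace E] [BorelSpace E] (μ : Measure E) [μ.IsAddHaarMeasure]

theorem tendsto_setAverage_ball {f : E → ℝ} (hf : Continuous f) (y : E) {s : ℕ → ℝ}
    (hs : ∀ k, 0 < s k) (hs0 : Tendsto s atTop (nhds 0)) :
    Tendsto (fun k => ⨍ z in ball y (s k), f z ∂μ) atTop (nhds (f y)) := by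
  rw [EMetric.tendsto_atTop]
  intro ε hε
  obtain ⟨ε', hε'0, hε'⟩ := exists_between hε
  obtain ⟨δ, hδ, hδ'⟩ := Metric.mem_nhds_iff.1
    (hf.continuousAt.preimage_mem_nhds (Metric.closedEBall_mem_nhds (f y) hε'0))
  obtain ⟨N, hN⟩ := (hs0.eventually_lt_const hδ).exists_forall_of_atTop
  refine ⟨N, fun k hk => lt_of_le_of_lt ?_ hε'⟩
  rw [edist_eq_enorm_sub]
  refine (enorm_setAverage_sub_le μ hf y (hs k) _).trans ?_
  have hμ0 : μ (ball y (s k)) ≠ 0 := (measure_ball_pos μ y (hs k)).ne'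
  have hμt : μ (ball y (s k)) ≠ ∞ := measure_ball_lt_top.ne
  calc _ ≤ (μ (ball y (s k)))⁻¹ * ∫⁻ z in ball y (s k), ε' ∂μ := by
        refine mul_le_mul' le_rfl (setLIntegral_mono' measurableSet_ball fun z hz => ?_)
        rw [← edist_eq_enorm_sub]
        exact hδ' (ball_subset_ball (hN k hk).le hz)
    _ = ε' := by
        rw [setLIntegral_const, mul_left_comm, ENNReal.inv_mul_cancel hμ0 hμt, mul_one]

/-- The telescoping estimate: a function minus its average over a ball is dominated by a dyadic
potential of its localised gradient. -/
theorem enorm_sub_setAverage_le_tsum {f : E → ℝ} (hf : Differentiable ℝ f) {x y : E} {j : ℤ}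
    (hy : y ∈ ball x (2 ^ j)) :
    ‖f y - ⨍ z in ball x (2 ^ (j + 1)), f z ∂μ‖ₑ ≤ 2 * 8 ^ Module.finrank ℝ E *
      ∑' i : ℤ, 2 ^ i * ((μ (ball y (2 ^ i)))⁻¹ * ∫⁻ z in ball y (2 ^ i),
        (ball x (2 ^ (j + 1))).indicator (fun z => ‖fderiv ℝ f z‖ₑ) z ∂μ) := by
  set d := Module.finrank ℝ E
  set H : E → ℝ≥0∞ := fun z => ‖fderiv ℝ f z‖ₑ with hHdef
  set B := ball x ((2 : ℝ) ^ (j + 1)) with hB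
  set T : ℤ → ℝ≥0∞ := fun i => 2 ^ i * ((μ (ball y (2 ^ i)))⁻¹ * ∫⁻ z in ball y (2 ^ i),
        B.indicator H z ∂μ) with hT
  have hj : (2 : ℝ) ^ (j + 1) = 2 * 2 ^ j := by rw [zpow_add₀ two_ne_zero]; ring
  have hj0 : (0 : ℝ) < 2 ^ j := by positivity
  have hyB : ball y (2 ^ j) ⊆ B := by
    intro z hz
    rw [hB, mem_ball, hj]
    rw [mem_ball] at hz hy
    linarith [dist_triangle z y x]
  have hvol : ∀ i : ℤ, (μ (ball y (2 ^ i)))⁻¹ = 4 ^ d * (μ (ball y (2 ^ (i + 2))))⁻¹ := by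
    intro i
    rw [addHaar_ball_two_zpow_add_two μ y y i, ENNReal.mul_inv (by simp) (by simp), ← mul_assoc,
      ENNReal.mul_inv_cancel (by simp) (by finiteness), one_mul]
  have h24 : (2 : ℝ≥0∞) ^ d * 4 ^ d = 8 ^ d := by rw [← mul_pow]; norm_num
  have hof : ∀ i : ℤ, ENNReal.ofReal (2 * 2 ^ i) = 2 * 2 ^ i := by
    intro i
    rw [ENNReal.ofReal_mul zero_le_two, ofReal_two_zpow]
    norm_num
  let a : ℕ → ℝ := fun k => Nat.casesOn k (⨍ z in B, f z ∂μ)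
    fun k => ⨍ z in ball y (2 ^ (j - 2 * (k : ℤ))), f z ∂μ
  have ha : Tendsto a atTop (nhds (f y)) := by
    rw [← tendsto_add_atTop_iff_nat 1]
    refine tendsto_setAverage_ball μ hf.continuous y (fun k => by positivity) ?_
    have : (fun k : ℕ => (2 : ℝ) ^ (j - 2 * (k : ℤ))) = fun k => 2 ^ j * (1 / 4) ^ k := by
      ext k
      rw [zpow_sub₀ two_ne_zero, zpow_mul, zpow_natCast, div_eq_mul_inv, ← inv_pow]
      norm_num
    rw [this]
    simpa using (tendsto_pow_atTop_nhds_zero_of_lt_one (by norm_num)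
      (by norm_num : (1 / 4 : ℝ) < 1)).const_mul (2 ^ j)
  have hstep : ∀ k : ℕ, edist (a k) (a (k + 1)) ≤ 2 * 8 ^ d * T (j + 2 - 2 * (k : ℤ)) := by
    intro k
    rw [edist_comm, edist_eq_enorm_sub]
    rcases k with _ | k
    · simp only [a, Nat.cast_zero, mul_zero, sub_zero, hT]
      refine (enorm_setAverage_sub_setAverage_le μ hf hj0 (by positivity) hyB).trans ?_
      rw [hvol, hof, ← h24]
      have hsub : B ⊆ ball y (2 ^ (j + 2)) := by
        intro z hz
        rw [hB, mem_ball, hj] at hz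
        rw [mem_ball] at hy ⊢
        have : (2 : ℝ) ^ (j + 2) = 4 * 2 ^ j := by rw [zpow_add₀ two_ne_zero]; ring
        linarith [dist_triangle_right z y x]
      have hI : ∫⁻ z in ball y (2 ^ (j + 2)), B.indicator H z ∂μ = ∫⁻ z in B, H z ∂μ := by
        rw [lintegral_indicator measurableSet_ball, Measure.restrict_restrict measurableSet_ball,
          inter_eq_left.2 hsub]
      rw [hI]
      have h2 : (2 : ℝ≥0∞) ^ (j + 1) ≤ 2 ^ (j + 2) :=
        ENNReal.zpow_le_of_le (by norm_num) (by omega)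
      calc 2 * 2 ^ (j + 1) * 2 ^ d * (4 ^ d * (μ (ball y (2 ^ (j + 2))))⁻¹ * ∫⁻ z in B, H z ∂μ)
          ≤ 2 * 2 ^ (j + 2) * 2 ^ d * (4 ^ d * (μ (ball y (2 ^ (j + 2))))⁻¹ * ∫⁻ z in B, H z ∂μ) := by
            gcongr
        _ = _ := by ring
    · have hi : j + 2 - 2 * ((k + 1 : ℕ) : ℤ) = j - 2 * (k : ℤ) := by push_cast; ring
      have hi2 : j - 2 * ((k + 1 : ℕ) : ℤ) + 2 = j - 2 * (k : ℤ) := by push_cast; ring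
      have hle : (2 : ℝ) ^ (j - 2 * (k : ℤ)) ≤ 2 ^ j := zpow_le_zpow_right₀ one_le_two (by omega)
      simp only [a, hT]
      rw [hi]
      refine (enorm_setAverage_sub_setAverage_le μ hf (by positivity) (by positivity)
        (ball_subset_ball (zpow_le_zpow_right₀ one_le_two (by omega)))).trans ?_
      rw [hvol, hi2, hof, ← h24]
      have hI : ∫⁻ z in ball y (2 ^ (j - 2 * (k : ℤ))), B.indicator H z ∂μ =
          ∫⁻ z in ball y (2 ^ (j - 2 * (k : ℤ))), H z ∂μ := by
        refine setLIntegral_congr_fun measurableSet_ball fun z hz => ?_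
        exact indicator_of_mem (hyB (ball_subset_ball hle hz)) _
      rw [hI]
      exact le_of_eq (by ring)
  have hfin := edist_le_tsum_of_edist_le_of_tendsto₀ _ hstep ha
  rw [edist_comm, edist_eq_enorm_sub] at hfin
  refine hfin.trans ?_
  rw [ENNReal.tsum_mul_left]
  refine mul_le_mul' le_rfl ?_
  exact ENNReal.tsum_comp_le_tsum_of_injective (fun k l h => by simpa using h) T
end

theorem inv_measure_mul_setLIntegral_le_rpow {X : Type*} [MeasurableSpace X] (μ : Measure X) {s : Set X}
    (hs0 : μ s ≠ 0) (hst : μ s ≠ ∞) {H : X → ℝ≥0∞} (hH : Measurable H) {α : ℝ} (hα : 1 < α) :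
    (μ s)⁻¹ * ∫⁻ x in s, H x ∂μ ≤ ((μ s)⁻¹ * ∫⁻ x in s, H x ^ α ∂μ) ^ (1 / α) := by
  set ν : Measure X := (μ s)⁻¹ • μ.restrict s with hν
  have := ENNReal.lintegral_mul_le_Lp_mul_Lq ν (Real.HolderConjugate.conjExponent hα)
    hH.aemeasurable (aemeasurable_const (b := (1 : ℝ≥0∞)))
  simpa [hν, lintegral_smul_measure, ENNReal.inv_mul_cancel hs0 hst] using this

section
variable {E : Type*} [NormedAddCommGroup E] [NormedSpace ℝ E] [FiniteDimensional ℝ E]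
  [MeasurableSpace E] [BorelSpace E] (μ : Measure E) [μ.IsAddHaarMeasure]

theorem addHaar_ball_two_zpow (x : E) (i : ℤ) :
    μ (ball x (2 ^ i)) = ((2 : ℝ≥0∞) ^ i) ^ (Module.finrank ℝ E : ℝ) * μ (ball 0 1) := by
  rw [Measure.addHaar_ball_of_pos _ _ (by positivity), ENNReal.ofReal_pow (by positivity),
    ofReal_two_zpow, ENNReal.rpow_natCast]

/-- The Sobolev–Poincaré inequality on dyadic balls. -/
theorem exists_sobolev_poincare {α : ℝ} (hα : 1 < α) (hαd : α < Module.finrank ℝ E) :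
    ∃ C : ℝ≥0∞, C ≠ ∞ ∧ ∀ f : E → ℝ, Differentiable ℝ f → ∀ (x : E) (j : ℤ),
      (∫⁻ y in ball x (2 ^ j), ‖f y - ⨍ z in ball x (2 ^ (j + 1)), f z ∂μ‖ₑ ^
        (α * Module.finrank ℝ E / (Module.finrank ℝ E - α)) ∂μ) ^
        ((Module.finrank ℝ E - α) / (α * Module.finrank ℝ E)) ≤
      C * (∫⁻ y in ball x (2 ^ (j + 1)), ‖fderiv ℝ f y‖ₑ ^ α ∂μ) ^ (1 / α) := by
  set d : ℝ := (Module.finrank ℝ E : ℝ) with hd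
  have hα0 : 0 < α := by linarith
  have hd0 : 0 < d := by linarith
  have hdα : 0 < d - α := by linarith
  have hγ : 0 < d / α - 1 := by rw [sub_pos, lt_div_iff₀ hα0]; linarith
  obtain ⟨C₁, hC₁, hmin⟩ := tsum_zpow_min_le hγ
  obtain ⟨C₂, hC₂, hM⟩ := exists_dyadicMaximal_strong_type E hα
  have e1 : (d / α - 1) / (1 + (d / α - 1)) = 1 - α / d := by field_simp; ring
  have e2 : 1 / (1 + (d / α - 1)) = α / d := by field_simp; ring
  rw [e1, e2] at hmin
  set σ : ℝ := α * d / (d - α) with hσ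
  have hσ0 : 0 < σ := by positivity
  have hσi : (d - α) / (α * d) = 1 / σ := by rw [hσ]; field_simp
  have hσi0 : 0 ≤ 1 / σ := by positivity
  have e3 : (1 - α / d) * σ = α := by rw [hσ]; field_simp
  set ω : ℝ≥0∞ := μ (ball 0 1) with hω
  have hω0 : ω ≠ 0 := (measure_ball_pos μ 0 one_pos).ne'
  have hωt : ω ≠ ∞ := measure_ball_lt_top.ne
  set D : ℝ≥0∞ := 2 * 8 ^ Module.finrank ℝ E * C₁ with hD
  have hDt : D ≠ ∞ := by finiteness
  refine ⟨D * (ω⁻¹ ^ (1 / α)) ^ (α / d) * C₂ ^ (1 / σ), ?_, fun f hf x j => ?_⟩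
  · refine ENNReal.mul_ne_top (ENNReal.mul_ne_top hDt ?_) ?_
    · refine ENNReal.rpow_ne_top_of_nonneg (by positivity) ?_
      exact ENNReal.rpow_ne_top_of_nonneg (by positivity) (ENNReal.inv_ne_top.2 hω0)
    · exact ENNReal.rpow_ne_top_of_nonneg (by positivity) hC₂
  set B := ball x ((2 : ℝ) ^ (j + 1)) with hB
  set H : E → ℝ≥0∞ := B.indicator fun z => ‖fderiv ℝ f z‖ₑ with hH
  have hHm : Measurable H := (measurable_fderiv ℝ f).enorm.indicator measurableSet_ball
  have hI : ∫⁻ y, H y ^ α ∂μ = ∫⁻ y in B, ‖fderiv ℝ f y‖ₑ ^ α ∂μ := by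
    rw [← lintegral_indicator measurableSet_ball]
    congr 1 with y
    by_cases hy : y ∈ B
    · rw [hH, indicator_of_mem hy, indicator_of_mem hy]
    · rw [hH, indicator_of_notMem hy, indicator_of_notMem hy, ENNReal.zero_rpow_of_pos hα0]
  rw [hσi, ← hI]
  set I := ∫⁻ y, H y ^ α ∂μ with hIdef
  set b : ℝ≥0∞ := ω⁻¹ ^ (1 / α) * I ^ (1 / α) with hb
  have hpt : ∀ y ∈ ball x ((2 : ℝ) ^ j), ‖f y - ⨍ z in B, f z ∂μ‖ₑ ≤
      D * (dyadicMaximal μ H y ^ (1 - α / d) * b ^ (α / d)) := by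
    intro y hy
    refine (enorm_sub_setAverage_le_tsum μ hf hy).trans ?_
    rw [hD, mul_assoc _ C₁]
    refine mul_le_mul' le_rfl (hmin _ _ _ (fun i => ?_) fun i => ?_)
    · refine mul_le_mul' le_rfl ?_
      exact le_iSup (fun k : ℤ => (μ (ball y (2 ^ k)))⁻¹ * ∫⁻ z in ball y (2 ^ k), H z ∂μ) i
    · have h2i0 : (2 : ℝ≥0∞) ^ i ≠ 0 := (ENNReal.zpow_pos (by simp) (by simp) i).ne'
      have h2it : (2 : ℝ≥0∞) ^ i ≠ ∞ := (ENNReal.zpow_lt_top (by simp) (by simp) i).ne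
      calc 2 ^ i * ((μ (ball y (2 ^ i)))⁻¹ * ∫⁻ z in ball y (2 ^ i), H z ∂μ)
          ≤ 2 ^ i * ((μ (ball y (2 ^ i)))⁻¹ * I) ^ (1 / α) := by
            refine mul_le_mul' le_rfl ?_
            refine (inv_measure_mul_setLIntegral_le_rpow μ (measure_ball_pos μ y (by positivity)).ne'
              measure_ball_lt_top.ne hHm hα).trans ?_
            gcongr
            exact setLIntegral_le_lintegral _ _
        _ = _ := by
            rw [addHaar_ball_two_zpow, ENNReal.mul_inv (Or.inr hωt) (Or.inr hω0), mul_assoc,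
              ENNReal.mul_rpow_of_nonneg _ _ (by positivity), ← ENNReal.rpow_neg, ← ENNReal.rpow_mul,
              ENNReal.mul_rpow_of_nonneg _ _ (by positivity), ← hb, ← mul_assoc]
            congr 1
            nth_rewrite 1 [← ENNReal.rpow_one ((2 : ℝ≥0∞) ^ i)]
            rw [← ENNReal.rpow_add _ _ h2i0 h2it]
            congr 1
            ring
  calc (∫⁻ y in ball x (2 ^ j), ‖f y - ⨍ z in B, f z ∂μ‖ₑ ^ σ ∂μ) ^ (1 / σ)
      ≤ (∫⁻ y in ball x (2 ^ j), (D * b ^ (α / d)) ^ σ * dyadicMaximal μ H y ^ α ∂μ) ^ (1 / σ) := by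
        refine ENNReal.rpow_le_rpow (setLIntegral_mono' measurableSet_ball fun y hy => ?_) hσi0
        refine (ENNReal.rpow_le_rpow (hpt y hy) hσ0.le).trans (le_of_eq ?_)
        rw [mul_left_comm, mul_comm, ENNReal.mul_rpow_of_nonneg _ _ hσ0.le, ← ENNReal.rpow_mul, e3]
    _ ≤ ((D * b ^ (α / d)) ^ σ * (C₂ * I)) ^ (1 / σ) := by
        refine ENNReal.rpow_le_rpow ?_ hσi0
        rw [lintegral_const_mul _ ((measurable_dyadicMaximal μ hHm).pow_const α)]
        refine mul_le_mul' le_rfl ((setLIntegral_le_lintegral _ _).trans (hM μ H hHm))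
    _ = D * (ω⁻¹ ^ (1 / α)) ^ (α / d) * C₂ ^ (1 / σ) * ((I ^ (1 / α)) ^ (α / d) * I ^ (1 / σ)) := by
        rw [ENNReal.mul_rpow_of_nonneg _ _ hσi0, ENNReal.mul_rpow_of_nonneg _ _ hσi0,
          ← ENNReal.rpow_mul, mul_one_div_cancel hσ0.ne', ENNReal.rpow_one, hb,
          ENNReal.mul_rpow_of_nonneg _ _ (by positivity)]
        ring
    _ = _ := by
        rw [← ENNReal.rpow_mul I, ← ENNReal.rpow_add_of_nonneg _ _ (by positivity) hσi0]
        congr 2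
        rw [hσ]; field_simp; ring
end

/-- The dyadic annulus of inner radius `2 ^ k` centred at the origin. -/
def dyadicAnnulus (E : Type*) [NormedAddCommGroup E] (k : ℤ) : Set E :=
  {y | 2 ^ k < ‖y‖ ∧ ‖y‖ ≤ 2 ^ (k + 1)}

theorem measurableSet_dyadicAnnulus {E : Type*} [NormedAddCommGroup E] [MeasurableSpace E]
    [BorelSpace E] (k : ℤ) : MeasurableSet (dyadicAnnulus E k) :=
  measurableSet_Ioc.preimage measurable_norm

theorem enorm_norm_pow_inv_le_of_mem_dyadicAnnulus {E : Type*} [NormedAddCommGroup E] {k : ℤ} {y : E} (n : ℕ)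
    (hy : y ∈ dyadicAnnulus E k) :
    ‖(‖y‖ ^ n)⁻¹‖ₑ ≤ ((2 : ℝ≥0∞) ^ k) ^ (-(n : ℝ)) := by
  have h2 : (0 : ℝ) < 2 ^ k := by positivity
  have hy0 : 0 < ‖y‖ := h2.trans hy.1
  rw [Real.enorm_of_nonneg (by positivity), ENNReal.rpow_neg, ENNReal.rpow_natCast,
    ← ofReal_two_zpow, ← ENNReal.ofReal_pow h2.le, ← ENNReal.ofReal_inv_of_pos (by positivity)]
  apply ENNReal.ofReal_le_ofReal
  have := hy.1.le
  gcongr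

section
variable {E : Type*} [NormedAddCommGroup E] [NormedSpace ℝ E] [FiniteDimensional ℝ E] [Nontrivial E]
  [MeasurableSpace E] [BorelSpace E] (μ : Measure E) [μ.IsAddHaarMeasure]

theorem integral_homogeneous_mul_norm {Ω : E → ℝ} (hΩ : ∀ c : ℝ, 0 < c → ∀ y, Ω (c • y) = Ω y)
    (φ : ℝ → ℝ) :
    ∫ y, Ω y * φ ‖y‖ ∂μ = (∫ z : sphere (0 : E) 1, Ω z ∂μ.toSphere) *
      ∫ r : Ioi (0 : ℝ), φ r ∂Measure.volumeIoiPow (Module.finrank ℝ E - 1) := by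
  calc ∫ y, Ω y * φ ‖y‖ ∂μ
      = ∫ y : ({(0)}ᶜ : Set E), Ω y.1 * φ (‖y.1‖) ∂(μ.comap (↑)) := by
        rw [integral_subtype_comap (measurableSet_singleton _).compl fun x ↦ Ω x * φ (‖x‖),
          restrict_compl_singleton]
    _ = ∫ y : ({(0)}ᶜ : Set E), Ω (homeomorphUnitSphereProd E y).1 *
          φ (homeomorphUnitSphereProd E y).2 ∂(μ.comap (↑)) := by
        congr 1 with y
        have hy : 0 < ‖y.1‖ := norm_pos_iff.2 y.2
        rw [homeomorphUnitSphereProd_apply_snd_coe, homeomorphUnitSphereProd_apply_fst_coe,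
          hΩ _ (inv_pos.2 hy)]
    _ = ∫ z, Ω z.1 * φ z.2 ∂μ.toSphere.prod (.volumeIoiPow (Module.finrank ℝ E - 1)) :=
        μ.measurePreserving_homeomorphUnitSphereProd.integral_comp
          (Homeomorph.measurableEmbedding _) fun z => Ω z.1 * φ z.2
    _ = _ := integral_prod_mul (fun z : sphere (0 : E) 1 => Ω z) fun r : Ioi (0 : ℝ) => φ r

theorem lintegral_homogeneous_mul_norm {Ω : E → ℝ≥0∞} (hΩm : Measurable Ω)
    (hΩ : ∀ c : ℝ, 0 < c → ∀ y, Ω (c • y) = Ω y) {φ : ℝ → ℝ≥0∞} (hφ : Measurable φ) :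
    ∫⁻ y, Ω y * φ ‖y‖ ∂μ = (∫⁻ z : sphere (0 : E) 1, Ω z ∂μ.toSphere) *
      ∫⁻ r : Ioi (0 : ℝ), φ r ∂Measure.volumeIoiPow (Module.finrank ℝ E - 1) := by
  calc ∫⁻ y, Ω y * φ ‖y‖ ∂μ
      = ∫⁻ y : ({(0)}ᶜ : Set E), Ω y.1 * φ (‖y.1‖) ∂(μ.comap (↑)) := by
        rw [lintegral_subtype_comap (measurableSet_singleton _).compl fun x ↦ Ω x * φ (‖x‖),
          restrict_compl_singleton]
    _ = ∫⁻ y : ({(0)}ᶜ : Set E), Ω (homeomorphUnitSphereProd E y).1 *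
          φ (homeomorphUnitSphereProd E y).2 ∂(μ.comap (↑)) := by
        congr 1 with y
        have hy : 0 < ‖y.1‖ := norm_pos_iff.2 y.2
        rw [homeomorphUnitSphereProd_apply_snd_coe, homeomorphUnitSphereProd_apply_fst_coe,
          hΩ _ (inv_pos.2 hy)]
    _ = ∫⁻ z, Ω z.1 * φ z.2 ∂μ.toSphere.prod (.volumeIoiPow (Module.finrank ℝ E - 1)) :=
        μ.measurePreserving_homeomorphUnitSphereProd.lintegral_comp_emb
          (Homeomorph.measurableEmbedding _) fun z => Ω z.1 * φ z.2
    _ = _ := lintegral_prod_mul (hΩm.comp measurable_subtype_coe).aemeasurable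
        (hφ.comp measurable_subtype_coe).aemeasurable

theorem setLIntegral_dyadicAnnulus_le {Ω : E → ℝ≥0∞} (hΩm : Measurable Ω)
    (hΩ : ∀ c : ℝ, 0 < c → ∀ y, Ω (c • y) = Ω y) (k : ℤ) :
    ∫⁻ y in dyadicAnnulus E k, Ω y ∂μ ≤ 4 ^ Module.finrank ℝ E *
      ((2 : ℝ≥0∞) ^ k) ^ (Module.finrank ℝ E : ℝ) * ∫⁻ z : sphere (0 : E) 1, Ω z ∂μ.toSphere := by
  set φ : ℝ → ℝ≥0∞ := (Ioc ((2 : ℝ) ^ k) (2 ^ (k + 1))).indicator 1 with hφ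
  have hφm : Measurable φ := measurable_one.indicator measurableSet_Ioc
  have h0 : (0 : ℝ) < 2 ^ (k + 2) := by positivity
  have hI : ∫⁻ y in dyadicAnnulus E k, Ω y ∂μ = ∫⁻ y, Ω y * φ ‖y‖ ∂μ := by
    rw [← lintegral_indicator (measurableSet_dyadicAnnulus k)]
    congr 1 with y
    by_cases hy : y ∈ dyadicAnnulus E k
    · have : ‖y‖ ∈ Ioc ((2 : ℝ) ^ k) (2 ^ (k + 1)) := hy
      rw [indicator_of_mem hy, hφ, indicator_of_mem this, Pi.one_apply, mul_one]
    · have : ‖y‖ ∉ Ioc ((2 : ℝ) ^ k) (2 ^ (k + 1)) := hy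
      rw [indicator_of_notMem hy, hφ, indicator_of_notMem this, mul_zero]
  rw [hI, lintegral_homogeneous_mul_norm μ hΩm hΩ hφm, mul_comm]
  refine mul_le_mul' ?_ le_rfl
  have hd : Module.finrank ℝ E - 1 + 1 = Module.finrank ℝ E :=
    Nat.sub_add_cancel Module.finrank_pos
  have hd1 : (1 : ℝ) ≤ (Module.finrank ℝ E : ℝ) := by exact_mod_cast Module.finrank_pos (R := ℝ) (M := E)
  calc ∫⁻ r : Ioi (0 : ℝ), φ r ∂Measure.volumeIoiPow (Module.finrank ℝ E - 1)
      ≤ ∫⁻ r : Ioi (0 : ℝ), (Iio (⟨2 ^ (k + 2), h0⟩ : Ioi (0 : ℝ))).indicator 1 r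
          ∂Measure.volumeIoiPow (Module.finrank ℝ E - 1) := by
        refine lintegral_mono fun r => ?_
        by_cases hr : (r : ℝ) ∈ Ioc ((2 : ℝ) ^ k) (2 ^ (k + 1))
        · have hr' : r ∈ Iio (⟨2 ^ (k + 2), h0⟩ : Ioi (0 : ℝ)) := by
            rw [mem_Iio, ← Subtype.coe_lt_coe]
            exact hr.2.trans_lt (zpow_lt_zpow_right₀ one_lt_two (by omega))
          rw [hφ, indicator_of_mem hr, indicator_of_mem hr']
          rfl
        · rw [hφ, indicator_of_notMem hr]; exact zero_le
    _ = ENNReal.ofReal ((2 ^ (k + 2)) ^ Module.finrank ℝ E / Module.finrank ℝ E) := by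
        rw [lintegral_indicator_one measurableSet_Iio, Measure.volumeIoiPow_apply_Iio, hd]
        congr 2
        exact_mod_cast hd
    _ ≤ ENNReal.ofReal ((2 ^ (k + 2)) ^ Module.finrank ℝ E) :=
        ENNReal.ofReal_le_ofReal (div_le_self (by positivity) hd1)
    _ = _ := by
        rw [ENNReal.ofReal_pow h0.le, ofReal_two_zpow, ENNReal.rpow_natCast, ← mul_pow]
        congr 1
        rw [ENNReal.zpow_add (by simp) (by simp), mul_comm]
        norm_num

theorem setIntegral_dyadicAnnulus_eq_zero {Ω : E → ℝ} (hΩ : ∀ c : ℝ, 0 < c → ∀ y, Ω (c • y) = Ω y)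
    (h0 : ∫ z : sphere (0 : E) 1, Ω z ∂μ.toSphere = 0) (n : ℕ) (k : ℤ) :
    ∫ y in dyadicAnnulus E k, Ω y / ‖y‖ ^ n ∂μ = 0 := by
  have := integral_homogeneous_mul_norm μ hΩ
    ((Ioc ((2 : ℝ) ^ k) (2 ^ (k + 1))).indicator fun r => (r ^ n)⁻¹)
  rw [h0, zero_mul] at this
  rw [← this, ← integral_indicator (measurableSet_dyadicAnnulus k)]
  congr 1 with y
  by_cases hy : y ∈ dyadicAnnulus E k
  · have : ‖y‖ ∈ Ioc ((2 : ℝ) ^ k) (2 ^ (k + 1)) := hy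
    rw [indicator_of_mem hy, indicator_of_mem this, div_eq_mul_inv]
  · have : ‖y‖ ∉ Ioc ((2 : ℝ) ^ k) (2 ^ (k + 1)) := hy
    rw [indicator_of_notMem hy, indicator_of_notMem this, mul_zero]

theorem integrableOn_dyadicAnnulus {Ω : E → ℝ} (hΩm : Measurable Ω)
    (hΩ : ∀ c : ℝ, 0 < c → ∀ y, Ω (c • y) = Ω y)
    (hΩi : Integrable (fun z : sphere (0 : E) 1 => Ω z) μ.toSphere) (n : ℕ) (k : ℤ) :
    IntegrableOn (fun y => Ω y / ‖y‖ ^ n) (dyadicAnnulus E k) μ := by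
  refine ⟨(hΩm.div (measurable_norm.pow_const n)).aestronglyMeasurable, ?_⟩
  have h2i0 : (2 : ℝ≥0∞) ^ k ≠ 0 := (ENNReal.zpow_pos (by simp) (by simp) k).ne'
  have h2it : (2 : ℝ≥0∞) ^ k ≠ ∞ := (ENNReal.zpow_lt_top (by simp) (by simp) k).ne
  rw [HasFiniteIntegral]
  calc ∫⁻ y in dyadicAnnulus E k, ‖Ω y / ‖y‖ ^ n‖ₑ ∂μ
      ≤ ∫⁻ y in dyadicAnnulus E k, ((2 : ℝ≥0∞) ^ k) ^ (-(n : ℝ)) * ‖Ω y‖ₑ ∂μ := by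
        refine setLIntegral_mono' (measurableSet_dyadicAnnulus k) fun y hy => ?_
        rw [div_eq_mul_inv, enorm_mul, mul_comm]
        exact mul_le_mul' (enorm_norm_pow_inv_le_of_mem_dyadicAnnulus n hy) le_rfl
    _ = ((2 : ℝ≥0∞) ^ k) ^ (-(n : ℝ)) * ∫⁻ y in dyadicAnnulus E k, ‖Ω y‖ₑ ∂μ :=
        lintegral_const_mul _ hΩm.enorm
    _ ≤ ((2 : ℝ≥0∞) ^ k) ^ (-(n : ℝ)) * (4 ^ Module.finrank ℝ E *
      ((2 : ℝ≥0∞) ^ k) ^ (Module.finrank ℝ E : ℝ) * ∫⁻ z : sphere (0 : E) 1, ‖Ω z‖ₑ ∂μ.toSphere) :=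
        mul_le_mul' le_rfl (setLIntegral_dyadicAnnulus_le μ hΩm.enorm
          (fun c hc y => by rw [hΩ c hc y]) k)
    _ < ∞ := by
        have h1 : ((2 : ℝ≥0∞) ^ k) ^ (-(n : ℝ)) ≠ ∞ := by
          simp [ENNReal.rpow_eq_top_iff, h2i0, h2it]
        have h3 : ((2 : ℝ≥0∞) ^ k) ^ (Module.finrank ℝ E : ℝ) ≠ ∞ := by
          exact ENNReal.rpow_ne_top_of_nonneg (by positivity) h2it
        have h4 : ∫⁻ z : sphere (0 : E) 1, ‖Ω z‖ₑ ∂μ.toSphere < ∞ := hΩi.2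
        exact (ENNReal.mul_lt_top h1.lt_top (ENNReal.mul_lt_top
          (ENNReal.mul_lt_top (by finiteness) h3.lt_top) h4))
end

theorem lintegral_enorm_rpow_le_of_exponent_le {X : Type*} [MeasurableSpace X] (τ : Measure X)
    {g : X → ℝ} (hg : Measurable g) {r s : ℝ} (hr : 0 < r) (hrs : r ≤ s) :
    (∫⁻ z, ‖g z‖ₑ ^ r ∂τ) ^ (1 / r) ≤
      (∫⁻ z, ‖g z‖ₑ ^ s ∂τ) ^ (1 / s) * τ univ ^ (1 / r - 1 / s) := by
  have := eLpNorm'_le_eLpNorm'_mul_rpow_measure_univ (μ := τ) hr hrs hg.aestronglyMeasurable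
  simpa only [eLpNorm'] using this

section
variable {E : Type*} [NormedAddCommGroup E] [NormedSpace ℝ E] [FiniteDimensional ℝ E] [Nontrivial E]
  [MeasurableSpace E] [BorelSpace E] (μ : Measure E) [μ.IsAddHaarMeasure]

theorem exists_enorm_setIntegral_dyadicAnnulus_le {α ρ : ℝ} (hα : 1 < α)
    (hαd : α < Module.finrank ℝ E) (hρ : 1 < ρ)
    (hρα : 1 / ρ ≤ 1 - 1 / α + 1 / Module.finrank ℝ E) :
    ∃ C : ℝ≥0∞, C ≠ ∞ ∧ ∀ Ω : E → ℝ, Measurable Ω → (∀ c : ℝ, 0 < c → ∀ y, Ω (c • y) = Ω y) →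
      Integrable (fun z : sphere (0 : E) 1 => Ω z) μ.toSphere →
      ∫ z : sphere (0 : E) 1, Ω z ∂μ.toSphere = 0 →
      ∀ f : E → ℝ, Differentiable ℝ f → ∀ (x : E) (k : ℤ),
      ‖∫ y in dyadicAnnulus E k, Ω y / ‖y‖ ^ Module.finrank ℝ E * f (x - y) ∂μ‖ₑ ≤
        C * (∫⁻ z : sphere (0 : E) 1, ‖Ω z‖ₑ ^ ρ ∂μ.toSphere) ^ (1 / ρ) *
          (2 ^ (k + 3) * ((μ (ball x (2 ^ (k + 3))))⁻¹ *
            ∫⁻ y in ball x (2 ^ (k + 3)), ‖fderiv ℝ f y‖ₑ ^ α ∂μ) ^ (1 / α)) := by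
  obtain ⟨C₁, hC₁, hSP⟩ := exists_sobolev_poincare μ hα hαd
  set d : ℝ := (Module.finrank ℝ E : ℝ) with hd
  have hα0 : 0 < α := by linarith
  have hd0 : 0 < d := by linarith
  have hdα : 0 < d - α := by linarith
  set σ : ℝ := α * d / (d - α) with hσ
  have hσ1 : 1 < σ := by rw [hσ, lt_div_iff₀ hdα]; nlinarith
  have hσ0 : 0 < σ := by positivity
  have hσi : (d - α) / (α * d) = 1 / σ := by rw [hσ]; field_simp
  have hσe : 1 / σ = 1 / α - 1 / d := by rw [hσ]; field_simp
  rw [hσi] at hSP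
  set s : ℝ := σ / (σ - 1) with hs
  have hσs : s.HolderConjugate σ := (Real.HolderConjugate.conjExponent hσ1).symm
  have hs0 : 0 < s := hσs.pos
  have hse : 1 / s = 1 - 1 / σ := by rw [hs]; field_simp
  have hsρ : s ≤ ρ := by
    rw [← one_div_le_one_div (by linarith) hs0]; linarith
  have hsρ' : 0 ≤ 1 / s - 1 / ρ := by linarith
  set ω : ℝ≥0∞ := μ (ball 0 1) with hω
  have hω0 : ω ≠ 0 := (measure_ball_pos μ 0 one_pos).ne'
  have hωt : ω ≠ ∞ := measure_ball_lt_top.ne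
  refine ⟨(4 ^ Module.finrank ℝ E) ^ (1 / s) * μ.toSphere univ ^ (1 / s - 1 / ρ) * C₁ *
    8 ^ (d / σ) * ω ^ (1 / α), ?_, fun Ω hΩm hΩ hΩi hΩ0 f hf x k => ?_⟩
  · have h1 : ((4 : ℝ≥0∞) ^ Module.finrank ℝ E) ^ (1 / s) ≠ ∞ :=
      ENNReal.rpow_ne_top_of_nonneg (by positivity) (by finiteness)
    have h2 : μ.toSphere univ ^ (1 / s - 1 / ρ) ≠ ∞ :=
      ENNReal.rpow_ne_top_of_nonneg hsρ' (by finiteness)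
    have h3 : (8 : ℝ≥0∞) ^ (d / σ) ≠ ∞ :=
      ENNReal.rpow_ne_top_of_nonneg (by positivity) (by finiteness)
    have h4 : ω ^ (1 / α) ≠ ∞ := ENNReal.rpow_ne_top_of_nonneg (by positivity) hωt
    exact ENNReal.mul_ne_top (ENNReal.mul_ne_top (ENNReal.mul_ne_top (ENNReal.mul_ne_top h1 h2) hC₁)
      h3) h4
  have h2i0 : (2 : ℝ≥0∞) ^ k ≠ 0 := (ENNReal.zpow_pos (by simp) (by simp) k).ne'
  have h2it : (2 : ℝ≥0∞) ^ k ≠ ∞ := (ENNReal.zpow_lt_top (by simp) (by simp) k).ne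
  set A := dyadicAnnulus E k with hA
  have hAm : MeasurableSet A := measurableSet_dyadicAnnulus k
  have hAball : ∀ y ∈ A, x - y ∈ ball x (2 ^ (k + 2)) := by
    intro y hy
    rw [mem_ball, dist_eq_norm, sub_sub_cancel_left, norm_neg]
    exact hy.2.trans_lt (zpow_lt_zpow_right₀ one_lt_two (by omega))
  set K : E → ℝ := fun y => Ω y / ‖y‖ ^ Module.finrank ℝ E with hK
  have hKi : IntegrableOn K A μ := integrableOn_dyadicAnnulus μ hΩm hΩ hΩi _ k
  set c : ℝ := ⨍ z in ball x (2 ^ (k + 3)), f z ∂μ with hc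
  set B := ball x ((2 : ℝ) ^ (k + 3)) with hB
  set I : ℝ≥0∞ := ∫⁻ y in B, ‖fderiv ℝ f y‖ₑ ^ α ∂μ with hI
  have hfc : Continuous fun y => f (x - y) := hf.continuous.comp (continuous_const.sub continuous_id)
  have hKf : IntegrableOn (fun y => K y * f (x - y)) A μ := by
    refine hKi.mul_continuousOn_of_subset hfc.continuousOn hAm
      (isCompact_closedBall (0 : E) (2 ^ (k + 1))) fun y hy => ?_
    simpa using hy.2
  have hsub : ∫ y in A, K y * f (x - y) ∂μ = ∫ y in A, K y * (f (x - y) - c) ∂μ := by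
    simp_rw [mul_sub]
    rw [integral_sub hKf (hKi.mul_const c), integral_mul_const,
      setIntegral_dyadicAnnulus_eq_zero μ hΩ hΩ0, zero_mul, sub_zero]
  have hfm : Measurable fun y => ‖f (x - y) - c‖ₑ := (hfc.measurable.sub_const c).enorm
  have hΩA : (∫⁻ y in A, ‖Ω y‖ₑ ^ s ∂μ) ^ (1 / s) ≤
      (4 ^ Module.finrank ℝ E) ^ (1 / s) * (2 ^ k) ^ (d / s) *
        ((∫⁻ z : sphere (0 : E) 1, ‖Ω z‖ₑ ^ ρ ∂μ.toSphere) ^ (1 / ρ) *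
          μ.toSphere univ ^ (1 / s - 1 / ρ)) := by
    calc _ ≤ (4 ^ Module.finrank ℝ E * (2 ^ k) ^ d *
          ∫⁻ z : sphere (0 : E) 1, ‖Ω z‖ₑ ^ s ∂μ.toSphere) ^ (1 / s) := by
          refine ENNReal.rpow_le_rpow ?_ (by positivity)
          exact setLIntegral_dyadicAnnulus_le μ (hΩm.enorm.pow_const s)
            (fun c hc y => by rw [hΩ c hc y]) k
      _ = (4 ^ Module.finrank ℝ E) ^ (1 / s) * (2 ^ k) ^ (d / s) *
          (∫⁻ z : sphere (0 : E) 1, ‖Ω z‖ₑ ^ s ∂μ.toSphere) ^ (1 / s) := by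
          rw [ENNReal.mul_rpow_of_nonneg _ _ (by positivity),
            ENNReal.mul_rpow_of_nonneg _ _ (by positivity), ← ENNReal.rpow_mul, mul_one_div]
      _ ≤ _ := mul_le_mul' le_rfl (lintegral_enorm_rpow_le_of_exponent_le _
          (hΩm.comp measurable_subtype_coe) hs0 hsρ)
  have hfA : (∫⁻ y in A, ‖f (x - y) - c‖ₑ ^ σ ∂μ) ^ (1 / σ) ≤ C₁ * I ^ (1 / α) := by
    have hk : k + 3 = k + 2 + 1 := by ring
    refine le_trans (ENNReal.rpow_le_rpow ?_ (by positivity)) (hk ▸ hSP f hf x (k + 2))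
    calc ∫⁻ y in A, ‖f (x - y) - c‖ₑ ^ σ ∂μ
        ≤ ∫⁻ y in A, (ball x (2 ^ (k + 2))).indicator (fun z => ‖f z - c‖ₑ ^ σ) (x - y) ∂μ :=
          setLIntegral_mono' hAm fun y hy => by rw [indicator_of_mem (hAball y hy)]
      _ ≤ ∫⁻ y, (ball x (2 ^ (k + 2))).indicator (fun z => ‖f z - c‖ₑ ^ σ) (x - y) ∂μ :=
          setLIntegral_le_lintegral _ _
      _ = ∫⁻ y in ball x (2 ^ (k + 2)), ‖f y - c‖ₑ ^ σ ∂μ := by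
          rw [lintegral_sub_left_eq_self (μ := μ)
            ((ball x (2 ^ (k + 2))).indicator fun z => ‖f z - c‖ₑ ^ σ) x,
            lintegral_indicator measurableSet_ball]
      _ = _ := by rw [hc, hB, hk]
  set t : ℝ≥0∞ := 2 ^ (k + 3) with ht
  have ht0 : t ≠ 0 := (ENNReal.zpow_pos (by simp) (by simp) _).ne'
  have htt : t ≠ ∞ := (ENNReal.zpow_lt_top (by simp) (by simp) _).ne
  have hkt : (2 : ℝ≥0∞) ^ k = t * 8⁻¹ := by
    rw [ht, ENNReal.zpow_add (by simp) (by simp), mul_assoc]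
    have : (2 : ℝ≥0∞) ^ (3 : ℤ) * 8⁻¹ = 1 := by
      rw [show (2 : ℝ≥0∞) ^ (3 : ℤ) = 8 by norm_cast]
      exact ENNReal.mul_inv_cancel (by simp) (by simp)
    rw [this, mul_one]
  have hIt : I ^ (1 / α) = t ^ (d / α) * ω ^ (1 / α) * ((μ B)⁻¹ * I) ^ (1 / α) := by
    have hBt : μ B = t ^ d * ω := addHaar_ball_two_zpow μ x (k + 3)
    have hB0 : μ B ≠ 0 := (measure_ball_pos μ x (by positivity)).ne'
    have hBtop : μ B ≠ ∞ := measure_ball_lt_top.ne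
    rw [← mul_one_div d α, ENNReal.rpow_mul, ← ENNReal.mul_rpow_of_nonneg _ _ (by positivity), ← hBt,
      ← ENNReal.mul_rpow_of_nonneg _ _ (by positivity), ← mul_assoc, ENNReal.mul_inv_cancel hB0 hBtop,
      one_mul]
  have hpow : (2 ^ k) ^ (-d) * (2 ^ k) ^ (d / s) * t ^ (d / α) = t * 8 ^ (d / σ) := by
    rw [← ENNReal.rpow_add _ _ h2i0 h2it]
    have e : -d + d / s = -(d / σ) := by
      rw [← mul_one_div d s, hse, ← mul_one_div d σ]; ring
    rw [e, hkt, ENNReal.mul_rpow_of_ne_top htt (by simp), ENNReal.inv_rpow, ENNReal.rpow_neg 8, inv_inv,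
      mul_right_comm, ← ENNReal.rpow_add _ _ ht0 htt]
    have e2 : -(d / σ) + d / α = 1 := by
      rw [← mul_one_div d σ, hσe, ← mul_one_div d α]; field_simp; ring
    rw [e2, ENNReal.rpow_one]
  calc ‖∫ y in A, K y * f (x - y) ∂μ‖ₑ
      ≤ ∫⁻ y in A, ‖K y * (f (x - y) - c)‖ₑ ∂μ := by
        rw [hsub]; exact enorm_integral_le_lintegral_enorm _
    _ ≤ ∫⁻ y in A, (2 ^ k) ^ (-d) * (‖Ω y‖ₑ * ‖f (x - y) - c‖ₑ) ∂μ := by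
        refine setLIntegral_mono' hAm fun y hy => ?_
        simp only [hK]
        rw [enorm_mul, div_eq_mul_inv, enorm_mul, mul_comm ‖Ω y‖ₑ, mul_assoc]
        exact mul_le_mul' (enorm_norm_pow_inv_le_of_mem_dyadicAnnulus _ hy) le_rfl
    _ = (2 ^ k) ^ (-d) * ∫⁻ y in A, ‖Ω y‖ₑ * ‖f (x - y) - c‖ₑ ∂μ :=
        lintegral_const_mul _ (hΩm.enorm.mul hfm)
    _ ≤ (2 ^ k) ^ (-d) * ((∫⁻ y in A, ‖Ω y‖ₑ ^ s ∂μ) ^ (1 / s) *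
          (∫⁻ y in A, ‖f (x - y) - c‖ₑ ^ σ ∂μ) ^ (1 / σ)) :=
        mul_le_mul' le_rfl (ENNReal.lintegral_mul_le_Lp_mul_Lq _ hσs hΩm.enorm.aemeasurable
          hfm.aemeasurable)
    _ ≤ _ := mul_le_mul' le_rfl (mul_le_mul' hΩA hfA)
    _ = ((2 ^ k) ^ (-d) * (2 ^ k) ^ (d / s) * t ^ (d / α)) * ((4 ^ Module.finrank ℝ E) ^ (1 / s) *
        ((∫⁻ z : sphere (0 : E) 1, ‖Ω z‖ₑ ^ ρ ∂μ.toSphere) ^ (1 / ρ) *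
          μ.toSphere univ ^ (1 / s - 1 / ρ)) * C₁ * (ω ^ (1 / α) * ((μ B)⁻¹ * I) ^ (1 / α))) := by
        rw [hIt]; ring
    _ = _ := by rw [hpow]; ring
end

theorem iUnion_dyadicAnnulus (E : Type*) [NormedAddCommGroup E] (m : ℤ) :
    ⋃ j : ℕ, dyadicAnnulus E (m + j) = {y : E | 2 ^ m < ‖y‖} := by
  ext y
  simp only [mem_iUnion, mem_ofPred_eq, dyadicAnnulus]
  constructor
  · rintro ⟨j, hj, -⟩
    exact lt_of_le_of_lt (zpow_le_zpow_right₀ one_le_two (by omega)) hj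
  · intro hy
    have hy0 : 0 < ‖y‖ := lt_trans (by positivity) hy
    obtain ⟨k, hk, hk'⟩ := exists_mem_Ioc_zpow hy0 (one_lt_two (α := ℝ))
    have hmk : m < k + 1 := (zpow_lt_zpow_iff_right₀ (one_lt_two (α := ℝ))).1 (hy.trans_le hk')
    obtain ⟨j, hj⟩ := Int.le.dest (Int.lt_add_one_iff.1 hmk)
    exact ⟨j, by rw [hj]; exact ⟨hk, hk'⟩⟩

theorem pairwise_disjoint_dyadicAnnulus (E : Type*) [NormedAddCommGroup E] (m : ℤ) :
    Pairwise (Function.onFun Disjoint fun j : ℕ => dyadicAnnulus E (m + j)) := by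
  refine (pairwise_disjoint_on _).2 fun i j hij => ?_
  refine Set.disjoint_left.2 fun y hi hj => ?_
  exact absurd (hi.2.trans (zpow_le_zpow_right₀ one_le_two (by omega))) hj.1.not_ge

theorem enorm_setIntegral_lt_norm_le_tsum {E : Type*} [NormedAddCommGroup E] [MeasurableSpace E]
    [BorelSpace E] (μ : Measure E) (F : E → ℝ) (m : ℤ) :
    ‖∫ y in {y : E | 2 ^ m < ‖y‖}, F y ∂μ‖ₑ ≤ ∑' k : ℤ, ‖∫ y in dyadicAnnulus E k, F y ∂μ‖ₑ := by
  by_cases hF : IntegrableOn F {y : E | 2 ^ m < ‖y‖} μ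
  · rw [← iUnion_dyadicAnnulus] at hF ⊢
    have hsum := hasSum_integral_iUnion (fun j : ℕ => measurableSet_dyadicAnnulus (E := E) (m + j))
      (pairwise_disjoint_dyadicAnnulus E m) hF
    rw [← hsum.tsum_eq]
    refine (enorm_tsum_le_tsum_enorm).trans ?_
    exact ENNReal.tsum_comp_le_tsum_of_injective (f := fun j : ℕ => m + j)
      (fun i j h => by simpa using h) fun k => ‖∫ y in dyadicAnnulus E k, F y ∂μ‖ₑ
  · rw [integral_undef hF]; simp

section
variable {E : Type*} [NormedAddCommGroup E] [NormedSpace ℝ E] [FiniteDimensional ℝ E] [Nontrivial E]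
  [MeasurableSpace E] [BorelSpace E] (μ : Measure E) [μ.IsAddHaarMeasure]

/-- The pointwise bound of a rough singular integral of `f` by the maximal function and a Morrey
norm of the gradient of `f`. -/
theorem exists_enorm_le_dyadicMaximal_rpow_mul {α β ρ : ℝ} (hα : 1 < α) (hαβ : α < β)
    (hβd : β < Module.finrank ℝ E) (hρ : 1 < ρ)
    (hρα : 1 / ρ ≤ 1 - 1 / α + 1 / Module.finrank ℝ E) :
    ∃ C : ℝ≥0∞, C ≠ ∞ ∧ ∀ Ω : E → ℝ, Measurable Ω → (∀ c : ℝ, 0 < c → ∀ y, Ω (c • y) = Ω y) →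
      Integrable (fun z : sphere (0 : E) 1 => Ω z) μ.toSphere →
      ∫ z : sphere (0 : E) 1, Ω z ∂μ.toSphere = 0 →
      ∀ f : E → ℝ, Differentiable ℝ f → ∀ N : ℝ≥0∞,
      (∀ (x : E) (k : ℤ), (((2 : ℝ≥0∞) ^ k) ^ (-(Module.finrank ℝ E - β)) *
        ∫⁻ y in ball x (2 ^ k), ‖fderiv ℝ f y‖ₑ ^ α ∂μ) ^ (1 / α) ≤ N) →
      ∀ (x : E) (a : ℝ), Tendsto (fun t : ℝ => ∫ y in {y : E | t < ‖y‖},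
        Ω y / ‖y‖ ^ Module.finrank ℝ E * f (x - y) ∂μ) (nhdsWithin 0 (Ioi 0)) (nhds a) →
      ‖a‖ₑ ≤ C * (∫⁻ z : sphere (0 : E) 1, ‖Ω z‖ₑ ^ ρ ∂μ.toSphere) ^ (1 / ρ) *
        (dyadicMaximal μ (fun y => ‖fderiv ℝ f y‖ₑ ^ α) x ^ (1 / α - 1 / β) * N ^ (α / β)) := by
  have hα0 : 0 < α := by linarith
  have hβ0 : 0 < β := by linarith
  obtain ⟨C₁, hC₁, hann⟩ := exists_enorm_setIntegral_dyadicAnnulus_le μ hα (hαβ.trans hβd) hρ hρα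
  have hγ : 0 < β / α - 1 := by rw [sub_pos, lt_div_iff₀ hα0]; linarith
  obtain ⟨C₂, hC₂, hmin⟩ := tsum_zpow_min_le hγ
  have e0 : 1 + (β / α - 1) = β / α := by ring
  have e1 : (β / α - 1) / (1 + (β / α - 1)) = 1 - α / β := by rw [e0]; field_simp
  have e2 : 1 / (1 + (β / α - 1)) = α / β := by rw [e0]; field_simp
  rw [e1, e2] at hmin
  set d : ℝ := (Module.finrank ℝ E : ℝ) with hd
  set ω : ℝ≥0∞ := μ (ball 0 1) with hω
  have hω0 : ω ≠ 0 := (measure_ball_pos μ 0 one_pos).ne'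
  have hωt : ω ≠ ∞ := measure_ball_lt_top.ne
  refine ⟨C₁ * C₂ * (ω⁻¹ ^ (1 / α)) ^ (α / β), ?_, fun Ω hΩm hΩ hΩi hΩ0 f hf N hN x a ha => ?_⟩
  · refine ENNReal.mul_ne_top (ENNReal.mul_ne_top hC₁ hC₂) ?_
    refine ENNReal.rpow_ne_top_of_nonneg (by positivity) ?_
    exact ENNReal.rpow_ne_top_of_nonneg (by positivity) (ENNReal.inv_ne_top.2 hω0)
  set P := (∫⁻ z : sphere (0 : E) 1, ‖Ω z‖ₑ ^ ρ ∂μ.toSphere) ^ (1 / ρ) with hP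
  set M := dyadicMaximal μ (fun y => ‖fderiv ℝ f y‖ₑ ^ α) x with hM
  set v : ℤ → ℝ≥0∞ := fun i => 2 ^ i * ((μ (ball x (2 ^ i)))⁻¹ *
    ∫⁻ y in ball x (2 ^ i), ‖fderiv ℝ f y‖ₑ ^ α ∂μ) ^ (1 / α) with hv
  have hvsum : ∑' i, v i ≤ C₂ * ((M ^ (1 / α)) ^ (1 - α / β) * (ω⁻¹ ^ (1 / α) * N) ^ (α / β)) := by
    refine hmin _ _ _ (fun i => ?_) fun i => ?_
    · refine mul_le_mul' le_rfl (ENNReal.rpow_le_rpow ?_ (by positivity))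
      exact le_iSup (fun k : ℤ => (μ (ball x (2 ^ k)))⁻¹ *
        ∫⁻ z in ball x (2 ^ k), ‖fderiv ℝ f z‖ₑ ^ α ∂μ) i
    · have h2i0 : (2 : ℝ≥0∞) ^ i ≠ 0 := (ENNReal.zpow_pos (by simp) (by simp) i).ne'
      have h2it : (2 : ℝ≥0∞) ^ i ≠ ∞ := (ENNReal.zpow_lt_top (by simp) (by simp) i).ne
      set T : ℝ≥0∞ := 2 ^ i with hT
      have hB : (μ (ball x (2 ^ i)))⁻¹ = T ^ (-β) * ω⁻¹ * T ^ (-(d - β)) := by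
        rw [addHaar_ball_two_zpow, ENNReal.mul_inv (Or.inr hωt) (Or.inr hω0), mul_right_comm,
          ← ENNReal.rpow_add _ _ h2i0 h2it, ← ENNReal.rpow_neg]
        congr 2
        ring
      simp only [hv]
      rw [hB, mul_assoc, ENNReal.mul_rpow_of_nonneg _ _ (by positivity),
        ENNReal.mul_rpow_of_nonneg (T ^ (-β)) _ (by positivity), ← mul_assoc, ← mul_assoc, ← mul_assoc]
      refine mul_le_mul' (mul_le_mul' (le_of_eq ?_) le_rfl) (hN x i)
      rw [← ENNReal.rpow_mul]
      change T * T ^ (-β * (1 / α)) = _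
      conv_lhs => enter [1]; rw [← ENNReal.rpow_one T]
      rw [← ENNReal.rpow_add _ _ h2i0 h2it]
      congr 1
      ring
  have hbound : ∀ m : ℤ, ‖∫ y in {y : E | 2 ^ m < ‖y‖},
      Ω y / ‖y‖ ^ Module.finrank ℝ E * f (x - y) ∂μ‖ₑ ≤ C₁ * P * ∑' i, v i := by
    intro m
    refine (enorm_setIntegral_lt_norm_le_tsum μ _ m).trans ?_
    rw [← (Equiv.addRight (3 : ℤ)).tsum_eq v, ← ENNReal.tsum_mul_left]
    exact ENNReal.tsum_le_tsum fun k => hann Ω hΩm hΩ hΩi hΩ0 f hf x k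
  have hlim : Tendsto (fun m : ℕ => (2 : ℝ) ^ (-(m : ℤ))) atTop (nhdsWithin 0 (Ioi 0)) := by
    refine tendsto_nhdsWithin_iff.2 ⟨?_, Eventually.of_forall fun m => ?_⟩
    · simpa using tendsto_pow_atTop_nhds_zero_of_lt_one (by norm_num) (by norm_num : (2⁻¹ : ℝ) < 1)
    · exact mem_Ioi.2 (by positivity)
  have hlim' := (continuous_enorm.tendsto a).comp (ha.comp hlim)
  refine (le_of_tendsto hlim' (Eventually.of_forall fun m => hbound _)).trans ?_
  refine (mul_le_mul' le_rfl hvsum).trans (le_of_eq ?_)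
  rw [← ENNReal.rpow_mul, ENNReal.mul_rpow_of_nonneg _ _ (by positivity)]
  have e3 : 1 / α * (1 - α / β) = 1 / α - 1 / β := by field_simp
  rw [e3]
  ring
end

/-- weighted refined Sobolev inequality: with the hypotheses of the pointwise
inequality, `α < p < ∞`, `w ∈ A_{p/α}`, `∇f ∈ Ṁ^{α,αn/β}`, `∇f ∈ L^p(w)` and
`q = p/(1-α/β)`, one has
`‖T_Ω f‖_{L^q(w)} ≤ C ‖Ω‖_{L^ρ(𝕊^{n-1})} ‖∇f‖_{Ṁ^{α,αn/β}}^{α/β} ‖∇f‖_{L^p(w)}^{1-α/β}`. -/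
theorem weighted_refined_sobolev (n : ℕ) (hn : 2 ≤ n) (ρ α β p q : ℝ) (hρ : 1 < ρ)
    (hρn : ρ < n) (hα₁ : ρ * n / (ρ * n + ρ - n) ≤ α) (hα : 1 < α) (hαβ : α < β) (hβ : β < n)
    (hαp : α < p) (hq : q = p / (1 - α / β)) :
    ∀ (w : EuclideanSpace ℝ (Fin n) → ℝ), Measurable w → (∀ y, 0 < w y) →
      IsMuckenhoupt n (p / α) w →
    ∃ C : ℝ, 0 < C ∧
      ∀ (Ω : EuclideanSpace ℝ (Fin n) → ℝ), Measurable Ω →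
        (∀ c : ℝ, 0 < c → ∀ y, Ω (c • y) = Ω y) →
        Integrable (fun z : sphere (0 : EuclideanSpace ℝ (Fin n)) 1 => Ω (z : EuclideanSpace ℝ (Fin n)))
          ((volume : Measure (EuclideanSpace ℝ (Fin n))).toSphere) →
        (∫ z : sphere (0 : EuclideanSpace ℝ (Fin n)) 1, Ω (z : EuclideanSpace ℝ (Fin n))
            ∂((volume : Measure (EuclideanSpace ℝ (Fin n))).toSphere)) = 0 →
      ∀ (f : EuclideanSpace ℝ (Fin n) → ℝ), Differentiable ℝ f →
        morreyNorm n α (α * n / β) (fun y => ‖fderiv ℝ f y‖) < ∞ →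
        (∫⁻ y, ENNReal.ofReal (‖fderiv ℝ f y‖ ^ p) * ENNReal.ofReal (w y)) < ∞ →
      ∀ (g : EuclideanSpace ℝ (Fin n) → ℝ),
        (∀ x, Tendsto (fun t : ℝ =>
            ∫ y in {y : EuclideanSpace ℝ (Fin n) | t < ‖y‖}, (Ω y / ‖y‖ ^ n) * f (x - y))
          (nhdsWithin 0 (Ioi 0)) (nhds (g x))) →
        (∫⁻ x, ENNReal.ofReal (|g x| ^ q) * ENNReal.ofReal (w x)) ^ (1 / q) ≤
          ENNReal.ofReal C *
            ((∫⁻ z : sphere (0 : EuclideanSpace ℝ (Fin n)) 1,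
                ENNReal.ofReal (|Ω (z : EuclideanSpace ℝ (Fin n))| ^ ρ)
                ∂((volume : Measure (EuclideanSpace ℝ (Fin n))).toSphere)) ^ (1 / ρ)) *
            (morreyNorm n α (α * n / β) (fun y => ‖fderiv ℝ f y‖)) ^ (α / β) *
            ((∫⁻ y, ENNReal.ofReal (‖fderiv ℝ f y‖ ^ p) * ENNReal.ofReal (w y)) ^ (1 / p)) ^
              (1 - α / β) := by
  intro w hwm hw0 hA
  obtain ⟨A, hA⟩ := hA
  have hd : Module.finrank ℝ (EuclideanSpace ℝ (Fin n)) = n := finrank_euclideanSpace_fin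
  have : Nontrivial (EuclideanSpace ℝ (Fin n)) := Module.nontrivial_of_finrank_pos (R := ℝ) (by omega)
  have hn0 : (0 : ℝ) < n := by linarith
  have hρ0 : 0 < ρ := by linarith
  have hα0 : 0 < α := by linarith
  have hβ0 : 0 < β := by linarith
  have hp0 : 0 < p := by linarith
  have hαβ1 : 0 < 1 - α / β := by rw [sub_pos, div_lt_one hβ0]; exact hαβ
  have hq0 : 0 < q := by rw [hq]; positivity
  have hs : 1 < p / α := by rwa [one_lt_div hα0]
  have hs1 : 0 < p / α - 1 := by linarith
  have hqs : (1 / α - 1 / β) * q = p / α := by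
    have : 1 / α - 1 / β = 1 / α * (1 - α / β) := by field_simp
    rw [this, hq, mul_assoc, mul_div_cancel₀ _ hαβ1.ne']; ring
  have hqi : 1 / q = 1 / p * (1 - α / β) := by rw [hq]; field_simp
  have hρα : 1 / ρ ≤ 1 - 1 / α + 1 / (Module.finrank ℝ (EuclideanSpace ℝ (Fin n)) : ℝ) := by
    rw [hd]
    have hden : 0 < ρ * n + ρ - n := by nlinarith
    have h1 := one_div_le_one_div_of_le (by positivity) hα₁
    have h2 : 1 / (ρ * n / (ρ * n + ρ - n)) = 1 + 1 / n - 1 / ρ := by field_simp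
    linarith
  set W : EuclideanSpace ℝ (Fin n) → ℝ≥0∞ := fun y => ENNReal.ofReal (w y) with hW
  have hWm : Measurable W := hwm.ennreal_ofReal
  obtain ⟨C₂, hC₂, hM⟩ := lintegral_dyadicMaximal_rpow_mul_le
    (volume : Measure (EuclideanSpace ℝ (Fin n))) hs hWm
    (fun x => (ENNReal.ofReal_pos.2 (hw0 x)).ne') (fun x => ENNReal.ofReal_ne_top)
    (ENNReal.ofReal_ne_top (r := A)) (fun z r hr => by
      have h := hA z r hr
      simp only [← ENNReal.ofReal_rpow_of_pos (hw0 _)] at h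
      exact h)
  obtain ⟨C₁, hC₁, hpt⟩ := exists_enorm_le_dyadicMaximal_rpow_mul
    (volume : Measure (EuclideanSpace ℝ (Fin n))) hα hαβ (by rw [hd]; exact hβ) hρ hρα
  set κ : ℝ≥0∞ := C₁ * C₂ ^ (1 / q) with hκ
  have hκt : κ ≠ ∞ := ENNReal.mul_ne_top hC₁ (ENNReal.rpow_ne_top_of_nonneg (by positivity) hC₂)
  refine ⟨κ.toReal + 1, by positivity, fun Ω hΩm hΩ hΩi hΩ0 f hf _ _ g hg => ?_⟩
  have hκC : κ ≤ ENNReal.ofReal (κ.toReal + 1) := by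
    rw [ENNReal.le_ofReal_iff_toReal_le hκt (by positivity)]; linarith
  have habs : ∀ (a : ℝ) {b : ℝ}, 0 ≤ b → ENNReal.ofReal (|a| ^ b) = ‖a‖ₑ ^ b := fun a b hb => by
    rw [← ENNReal.ofReal_rpow_of_nonneg (abs_nonneg a) hb, ← Real.norm_eq_abs, ofReal_norm]
  have hnorm : ∀ (y : EuclideanSpace ℝ (Fin n)) {b : ℝ}, 0 ≤ b →
      ENNReal.ofReal (‖fderiv ℝ f y‖ ^ b) = ‖fderiv ℝ f y‖ₑ ^ b := fun y b hb => by
    rw [← ENNReal.ofReal_rpow_of_nonneg (norm_nonneg _) hb, ofReal_norm]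
  set N : ℝ≥0∞ := morreyNorm n α (α * n / β) (fun y => ‖fderiv ℝ f y‖) with hN
  have hNb : ∀ (x : EuclideanSpace ℝ (Fin n)) (k : ℤ),
      (((2 : ℝ≥0∞) ^ k) ^ (-(Module.finrank ℝ (EuclideanSpace ℝ (Fin n)) - β)) *
      ∫⁻ y in ball x (2 ^ k), ‖fderiv ℝ f y‖ₑ ^ α) ^ (1 / α) ≤ N := by
    intro x k
    have h2k : (0 : ℝ) < 2 ^ k := by positivity
    refine le_trans (le_of_eq ?_) (le_iSup_of_le x (le_iSup_of_le (2 ^ k) (le_iSup_of_le h2k le_rfl)))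
    simp only [abs_norm, hnorm _ hα0.le]
    rw [← ENNReal.ofReal_rpow_of_pos h2k, ofReal_two_zpow, hd]
    congr 4
    field_simp
  simp only [habs _ hρ0.le, habs _ hq0.le, hnorm _ hp0.le]
  set P := (∫⁻ z : sphere (0 : EuclideanSpace ℝ (Fin n)) 1,
    ‖Ω z‖ₑ ^ ρ ∂(volume : Measure (EuclideanSpace ℝ (Fin n))).toSphere) ^ (1 / ρ) with hP
  set J := ∫⁻ y, ‖fderiv ℝ f y‖ₑ ^ p * ENNReal.ofReal (w y) with hJ
  set H : EuclideanSpace ℝ (Fin n) → ℝ≥0∞ := fun y => ‖fderiv ℝ f y‖ₑ ^ α with hH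
  have hHm : Measurable H := (measurable_fderiv ℝ f).enorm.pow_const α
  have hHJ : ∫⁻ x, H x ^ (p / α) * W x = J := by
    simp only [hH, ← ENNReal.rpow_mul, mul_div_cancel₀ _ hα0.ne', hJ, hW]
  have hMm : Measurable fun x => dyadicMaximal volume H x ^ (p / α) * W x :=
    ((measurable_dyadicMaximal volume hHm).pow_const _).mul hWm
  have hgx : ∀ x, ‖g x‖ₑ ≤ C₁ * P * (dyadicMaximal volume H x ^ (1 / α - 1 / β) * N ^ (α / β)) :=
    fun x => hpt Ω hΩm hΩ hΩi hΩ0 f hf N hNb x (g x) (by rw [hd]; exact hg x)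
  calc (∫⁻ x, ‖g x‖ₑ ^ q * ENNReal.ofReal (w x)) ^ (1 / q)
      ≤ (∫⁻ x, (C₁ * P * N ^ (α / β)) ^ q * (dyadicMaximal volume H x ^ (p / α) * W x)) ^ (1 / q) := by
        refine ENNReal.rpow_le_rpow (lintegral_mono fun x => ?_) (by positivity)
        rw [← mul_assoc]
        refine mul_le_mul' ((ENNReal.rpow_le_rpow (hgx x) hq0.le).trans (le_of_eq ?_)) le_rfl
        rw [mul_comm (dyadicMaximal volume H x ^ _), ← mul_assoc, ENNReal.mul_rpow_of_nonneg _ _ hq0.le,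
          ← ENNReal.rpow_mul, hqs]
    _ ≤ ((C₁ * P * N ^ (α / β)) ^ q * (C₂ * J)) ^ (1 / q) := by
        refine ENNReal.rpow_le_rpow ?_ (by positivity)
        rw [lintegral_const_mul _ hMm, ← hHJ]
        exact mul_le_mul' le_rfl (hM H hHm)
    _ = κ * P * N ^ (α / β) * (J ^ (1 / p)) ^ (1 - α / β) := by
        rw [ENNReal.mul_rpow_of_nonneg _ _ (by positivity), ENNReal.mul_rpow_of_nonneg C₂ _ (by positivity),
          ← ENNReal.rpow_mul, mul_one_div_cancel hq0.ne', ENNReal.rpow_one, ← ENNReal.rpow_mul, ← hqi, hκ]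
        ring
    _ ≤ _ := by gcongr
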